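/- arXiv:2510.11332 — 6 statements merged into one kernel-verified Lean document; each statement's English description precedes it below -/
import Mathlib

section
/- Let E and F be Fréchet spaces and let T : E → F be a continuous linear operator. If the range T(E) is not closed in F, then there exists a closed infinite-dimensional linear subspace M of F such that M ∩ T(E) = {0}; in particular, M \ {0} is contained in the complement F \ T(E). -/
open Filter Set Topology Pointwise

section Group

variable {G : Type*} [AddCommGroup G] [UniformSpace G] [IsUniformAddGroup G]

/-- In a first countable complete abelian group there is a neighbourhood basis of `0` such that
every family whose `n`-th term lies in the `n`-th member of the basis is summable. -/
theorem exists_antitone_basis_nhds_zero_summable [CompleteSpace G] [FirstCountableTopology G] :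
    ∃ u : ℕ → Set G, (𝓝 0).HasAntitoneBasis u ∧
      ∀ x : ℕ → G, (∀ n, x n ∈ u n) → Summable x := by
  obtain ⟨u, hu, hadd⟩ := IsTopologicalAddGroup.exists_antitone_basis_nhds_zero G
  refine ⟨fun n ↦ u (n + 1), hu.comp_mono (fun _ _ h ↦ Nat.succ_le_succ h)
    (tendsto_add_atTop_nat 1), fun x hx ↦ ?_⟩
  have key : ∀ t : Finset ℕ, ∀ m, (∀ i ∈ t, m ≤ i) → ∑ i ∈ t, x i ∈ u m := by
    intro t
    induction t using Finset.induction_on_min with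
    | empty => exact fun m _ ↦ by simpa using mem_of_mem_nhds (hu.mem m)
    | insert a s has ih =>
      intro m hm
      rw [Finset.sum_insert fun h ↦ lt_irrefl _ (has a h)]
      exact hu.antitone (hm a (Finset.mem_insert_self _ _))
        (hadd a (add_mem_add (hx a) (ih (a + 1) fun i hi ↦ has i hi)))
  refine summable_iff_vanishing.2 fun e he ↦ ?_
  obtain ⟨m, hm⟩ := hu.mem_iff.1 he
  refine ⟨Finset.range m, fun t ht ↦ hm (key t m fun i hi ↦ ?_)⟩
  simpa using Finset.disjoint_left.1 ht hi

/-- An almost open continuous homomorphism from a complete first countable group has closed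
range. -/
theorem AddMonoidHom.isClosed_range_of_almost_open [CompleteSpace G] [FirstCountableTopology G]
    {H : Type*} [AddCommGroup H] [TopologicalSpace H] [IsTopologicalAddGroup H] [T2Space H]
    [FirstCountableTopology H] (T : G →+ H) (hT : Continuous T)
    (hopen : ∀ U ∈ 𝓝 (0 : G), ∃ O ∈ 𝓝 (0 : H),
      closure (Set.range T) ∩ O ⊆ closure (T '' U)) :
    IsClosed (Set.range T) := by
  obtain ⟨u, hu, hsum⟩ := exists_antitone_basis_nhds_zero_summable (G := G)
  obtain ⟨v, hv⟩ := (𝓝 (0 : H)).exists_antitone_basis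
  choose O hO hOsub using fun n ↦ hopen (u n) (hu.mem n)
  let C : AddSubgroup H := T.range.topologicalClosure
  have hC : (C : Set H) = closure (Set.range T) := by simp [C]
  have hTC : ∀ x, T x ∈ C := fun x ↦ T.range.le_topologicalClosure ⟨x, rfl⟩
  have hP : ∀ n, O n ∩ v n ∈ 𝓝 (0 : H) := fun n ↦ inter_mem (hO n) (hv.mem n)
  have near : ∀ (r : H) (s : Set G) (n : ℕ), r ∈ closure (T '' s) →
      ∃ x ∈ s, r - T x ∈ O n ∩ v n := by
    intro r s n hr
    have : (fun w ↦ r - w) ⁻¹' (O n ∩ v n) ∈ 𝓝 r :=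
      (continuous_const.sub continuous_id).continuousAt.preimage_mem_nhds (by simpa using hP n)
    obtain ⟨_, hw, x, hx, rfl⟩ := mem_closure_iff_nhds.1 hr _ this
    exact ⟨x, hx, hw⟩
  refine isClosed_of_closure_subset fun y hy ↦ ?_
  obtain ⟨x₀, -, hx₀⟩ := near y univ 0 (by simpa using hy)
  have step : ∀ n (r : {r : H // r ∈ C ∧ r ∈ O n ∩ v n}), ∃ x ∈ u n,
      ∃ r' : {r : H // r ∈ C ∧ r ∈ O (n + 1) ∩ v (n + 1)}, (r' : H) = r - T x := by
    rintro n ⟨r, hrC, hr⟩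
    obtain ⟨x, hx, h⟩ := near r (u n) (n + 1) (hOsub n ⟨hC ▸ hrC, hr.1⟩)
    exact ⟨x, hx, ⟨r - T x, C.sub_mem hrC (hTC x), h⟩, rfl⟩
  choose x hx r' hr' using step
  let ρ : ∀ n, {r : H // r ∈ C ∧ r ∈ O n ∩ v n} := fun n ↦
    Nat.rec ⟨y - T x₀, C.sub_mem (show y ∈ (C : Set H) from hC ▸ hy) (hTC x₀), hx₀⟩ r' n
  have hρ : ∀ n, (ρ (n + 1)).1 = (ρ n).1 - T (x n (ρ n)) := fun n ↦ hr' n (ρ n)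
  have hρ0 : Tendsto (fun n ↦ (ρ n).1) atTop (𝓝 0) := hv.tendsto fun n ↦ (ρ n).2.2.2
  have hs : Summable fun n ↦ x n (ρ n) := hsum _ fun n ↦ hx n (ρ n)
  have h1 := (hs.hasSum.map T hT).tendsto_sum_nat
  have h2 : ∀ n, ∑ i ∈ Finset.range n, (T ∘ fun n ↦ x n (ρ n)) i = y - T x₀ - (ρ n).1 := by
    intro n
    induction n with
    | zero => simp [ρ]
    | succ n ih => rw [Finset.sum_range_succ, ih, hρ]; simp only [Function.comp_apply]; abel
  have h3 := tendsto_nhds_unique h1 (((tendsto_const_nhds (x := y - T x₀)).sub hρ0).congr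
    fun n ↦ (h2 n).symm)
  exact ⟨(∑' n, x n (ρ n)) + x₀, by rw [map_add, h3]; simp⟩

end Group

section Recursion

/-- Strong recursion: a sequence each of whose terms satisfies a solvable condition depending on the
previous terms. -/
theorem exists_seq_of_forall_fin {α : Type*} (P : ∀ n : ℕ, (Fin n → α) → α → Prop)
    (h : ∀ n t, ∃ a, P n t a) : ∃ s : ℕ → α, ∀ n, P n (fun i ↦ s i) (s n) := by
  choose g hg using h
  let s : ℕ → α := fun n ↦ Nat.strongRec (fun n ih ↦ g n fun i ↦ ih i i.2) n
  refine ⟨s, fun n ↦ ?_⟩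
  have : s n = g n fun i ↦ s i := by
    simp only [s]
    rw [Nat.strongRec_eq]
  rw [this]
  exact hg _ _

end Recursion

section Functionals

variable {𝕜 : Type*} [RCLike 𝕜] {F : Type*} [AddCommGroup F] [Module 𝕜 F] [TopologicalSpace F]

/-- A set of functionals is unbounded near zero on a subspace if it is not equicontinuous there. -/
def UnboundedNearZero (A : Set (StrongDual 𝕜 F)) (Y : Submodule 𝕜 F) : Prop :=
  ∀ O ∈ 𝓝 (0 : F), ∀ c : ℝ, ∃ y ∈ Y, y ∈ O ∧ ∃ f ∈ A, c < ‖f y‖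

theorem UnboundedNearZero.inf_ker [IsTopologicalAddGroup F] [ContinuousSMul 𝕜 F]
    {A : Set (StrongDual 𝕜 F)} {Y : Submodule 𝕜 F}
    (h : UnboundedNearZero A Y) (hA : ∀ y ∈ Y, ∃ c, ∀ f ∈ A, ‖f y‖ ≤ c) (g : StrongDual 𝕜 F) :
    UnboundedNearZero A (Y ⊓ g.ker) := by
  by_cases hg : ∀ y ∈ Y, g y = 0
  · rwa [inf_eq_left.2 fun y hy ↦ hg y hy]
  push Not at hg
  obtain ⟨w, hwY, hw⟩ := hg
  obtain ⟨b, hb⟩ := hA w hwY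
  intro O hO c
  have hO' : {y | y - (g y / g w) • w ∈ O} ∩ {y | ‖g y / g w‖ < 1} ∈ 𝓝 (0 : F) := by
    refine inter_mem ?_ ?_
    · have : Continuous fun y ↦ y - (g y / g w) • w := by fun_prop
      exact this.continuousAt.preimage_mem_nhds (by simpa using hO)
    · have : Continuous fun y ↦ ‖g y / g w‖ := by fun_prop
      exact this.continuousAt.eventually_lt_const (by simp)
  obtain ⟨y, hyY, ⟨hyO, hy1⟩, f, hf, hfy⟩ := h _ hO' (c + b)
  refine ⟨y - (g y / g w) • w, ⟨Y.sub_mem hyY (Y.smul_mem _ hwY), ?_⟩, hyO, f, hf, ?_⟩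
  · simp [hw]
  · have h1 : ‖f y‖ ≤ ‖f (y - (g y / g w) • w)‖ + ‖g y / g w‖ * ‖f w‖ := by
      rw [← norm_mul, map_sub, map_smul, smul_eq_mul]
      simpa using norm_add_le (f y - g y / g w * f w) (g y / g w * f w)
    have h2 : ‖g y / g w‖ * ‖f w‖ ≤ 1 * b :=
      mul_le_mul hy1.le (hb f hf) (norm_nonneg _) zero_le_one
    linarith

theorem UnboundedNearZero.inf_iInf_ker [IsTopologicalAddGroup F] [ContinuousSMul 𝕜 F]
    {A : Set (StrongDual 𝕜 F)} {Y : Submodule 𝕜 F}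
    (h : UnboundedNearZero A Y) (hA : ∀ y ∈ Y, ∃ c, ∀ f ∈ A, ‖f y‖ ≤ c) {ι : Type*}
    (s : Finset ι) (g : ι → StrongDual 𝕜 F) :
    UnboundedNearZero A (Y ⊓ ⨅ i ∈ s, (g i).ker) := by
  classical
  induction s using Finset.induction_on with
  | empty => simpa using h
  | insert i s hi ih =>
    rw [Finset.iInf_insert, inf_comm (g i).ker, ← inf_assoc]
    exact ih.inf_ker (fun y hy ↦ hA y hy.1) (g i)

/-- A separable subset of a locally convex space is separated from zero by countably many
functionals. -/
theorem TopologicalSpace.IsSeparable.exists_seq_dual_separating [IsTopologicalAddGroup F]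
    [ContinuousSMul 𝕜 F] [Module ℝ F] [IsScalarTower ℝ 𝕜 F] [LocallyConvexSpace ℝ F]
    [FirstCountableTopology F] [T1Space F] {S : Set F} (hS : IsSeparable S) :
    ∃ h : ℕ → StrongDual 𝕜 F, ∀ z ∈ S, (∀ n, h n z = 0) → z = 0 := by
  have : ContinuousSMul ℝ F := IsScalarTower.continuousSMul 𝕜
  obtain ⟨D, hDc, hD⟩ := hS
  obtain ⟨u, hu, hub⟩ :=
    (LocallyConvexSpace.convex_open_basis_zero ℝ F).exists_antitone_subbasis
  have hex : ∀ (d : F) (i : ℕ), ∃ f : StrongDual 𝕜 F, d ∉ u i →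
      ∀ a ∈ u i, RCLike.re (f a) < RCLike.re (f d) := by
    intro d i
    by_cases hd : d ∈ u i
    · exact ⟨0, fun h ↦ absurd hd h⟩
    · obtain ⟨f, hf⟩ := RCLike.geometric_hahn_banach_open_point (𝕜 := 𝕜) (hu i).2.2 (hu i).2.1 hd
      exact ⟨f, fun _ ↦ hf⟩
  choose f hf using hex
  have hsep : ∀ z ∈ S, (∀ d ∈ D, ∀ i, f d i z = 0) → z = 0 := by
    intro z hz h0
    by_contra hne
    obtain ⟨V, hV, hVsub⟩ := exists_nhds_half_neg (isOpen_compl_singleton.mem_nhds (Ne.symm hne))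
    obtain ⟨i, hi⟩ := hub.mem_iff.1 hV
    have hnear : (fun d ↦ d - z) ⁻¹' u i ∈ 𝓝 z :=
      (continuous_id.sub continuous_const).continuousAt.preimage_mem_nhds
        (by simpa using hub.mem i)
    obtain ⟨d, hd, hdD⟩ := mem_closure_iff_nhds.1 (hD hz) _ hnear
    have hdi : d ∉ u i := fun h ↦ hVsub d (hi h) (d - z) (hi hd) (by simp)
    simpa [h0 d hdD i] using hf d i hdi _ hd
  have hc : ({0} ∪ (fun p : F × ℕ ↦ f p.1 p.2) '' (D ×ˢ univ)).Countable :=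
    (countable_singleton _).union ((hDc.prod countable_univ).image _)
  obtain ⟨h, hh⟩ := hc.exists_eq_range ⟨0, Or.inl rfl⟩
  refine ⟨h, fun z hz h0 ↦ hsep z hz fun d hd i ↦ ?_⟩
  obtain ⟨n, hn⟩ : f d i ∈ range h := hh ▸ Or.inr ⟨(d, i), ⟨hd, mem_univ _⟩, rfl⟩
  rw [← hn, h0]

/-- A sequence of functionals that is triangular with respect to a sequence of vectors can be
turned into a biorthogonal one. -/
theorem exists_biorthogonal_of_triangular [IsTopologicalAddGroup F] [ContinuousSMul 𝕜 F]
    (y : ℕ → F) (f : ℕ → StrongDual 𝕜 F)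
    (hlt : ∀ n m, n < m → f n (y m) = 0) (hne : ∀ n, f n (y n) ≠ 0) :
    ∃ b : ℕ → StrongDual 𝕜 F, (∀ n m, b n (y m) = if n = m then 1 else 0) ∧
      ∀ n x, f n x = ∑ m ∈ Finset.range n, f n (y m) * b m x + f n (y n) * b n x := by
  obtain ⟨b, hb⟩ := exists_seq_of_forall_fin
    (fun n (t : Fin n → StrongDual 𝕜 F) a ↦
      a = (f n (y n))⁻¹ • (f n - ∑ i : Fin n, f n (y i) • t i)) fun n t ↦ ⟨_, rfl⟩
  have hbx : ∀ n x, f n x = ∑ m ∈ Finset.range n, f n (y m) * b m x + f n (y n) * b n x := by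
    intro n x
    rw [hb n, Finset.sum_range]
    simp [hne n]
  refine ⟨b, fun n ↦ ?_, hbx⟩
  induction n using Nat.strong_induction_on with
  | h n ih =>
    intro m
    have h := hbx n (y m)
    rw [Finset.sum_congr rfl fun i hi ↦ by rw [ih i (Finset.mem_range.1 hi) m]] at h
    simp only [mul_ite, mul_one, mul_zero, Finset.sum_ite_eq', Finset.mem_range] at h
    rcases lt_trichotomy n m with hnm | rfl | hnm
    · rw [hlt n m hnm, if_neg (by omega)] at h
      simpa [hne n, hnm.ne] using h
    · simpa [hne n] using h
    · simpa [hnm, hne n, hnm.ne'] using h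

end Functionals

section Frechet

variable {𝕜 : Type*} [RCLike 𝕜] {F : Type*} [AddCommGroup F] [Module 𝕜 F] [UniformSpace F]
  [IsUniformAddGroup F] [ContinuousSMul 𝕜 F] [Module ℝ F] [IsScalarTower ℝ 𝕜 F]
  [LocallyConvexSpace ℝ F] [FirstCountableTopology F] [T2Space F]

/-- If an operator has non-closed range, some pointwise bounded set of functionals on its range
is not equicontinuous. -/
theorem ContinuousLinearMap.exists_unboundedNearZero_range {E : Type*} [AddCommGroup E]
    [Module 𝕜 E] [UniformSpace E] [IsUniformAddGroup E] [ContinuousSMul 𝕜 E] [CompleteSpace E]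
    [FirstCountableTopology E] [Module ℝ E] [IsScalarTower ℝ 𝕜 E] [LocallyConvexSpace ℝ E]
    (T : E →L[𝕜] F) (hT : ¬ IsClosed (Set.range T)) :
    ∃ A : Set (StrongDual 𝕜 F), (∀ y ∈ T.range, ∃ c, ∀ f ∈ A, ‖f y‖ ≤ c) ∧
      UnboundedNearZero A T.range := by
  have : ContinuousSMul ℝ F := IsScalarTower.continuousSMul 𝕜
  by_contra! hcon
  refine hT (AddMonoidHom.isClosed_range_of_almost_open (T : E →+ F) T.continuous fun U hU ↦ ?_)
  obtain ⟨U', ⟨hU', hconv⟩, hUU'⟩ := (LocallyConvexSpace.convex_basis_zero ℝ E).mem_iff.1 hU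
  have hbdd : ∀ y ∈ T.range,
      ∃ c, ∀ f ∈ {f : StrongDual 𝕜 F | ∀ x ∈ U', RCLike.re (f (T x)) ≤ 1}, ‖f y‖ ≤ c := by
    rintro _ ⟨x, rfl⟩
    have hx : (fun r : 𝕜 ↦ r • x) ⁻¹' U' ∈ 𝓝 0 :=
      (continuous_id.smul continuous_const).continuousAt.preimage_mem_nhds (by simpa using hU')
    obtain ⟨ε, hε, hball⟩ := Metric.nhds_basis_closedBall.mem_iff.1 hx
    refine ⟨1 / ε, fun f hf ↦ ?_⟩
    change ‖f (T x)‖ ≤ 1 / ε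
    by_cases h0 : f (T x) = 0
    · simp [h0, hε.le]
    have hn : ‖f (T x)‖ ≠ 0 := norm_ne_zero_iff.2 h0
    let r : 𝕜 := ((ε / ‖f (T x)‖ : ℝ) : 𝕜) * (starRingEnd 𝕜) (f (T x))
    have hr : ‖r‖ = ε := by simp [r, abs_of_pos hε, hn]
    have h1 := hf (r • x) (hball (by simp [hr]))
    have h2 : f (T (r • x)) = ((ε * ‖f (T x)‖ : ℝ) : 𝕜) := by
      rw [map_smul, map_smul, smul_eq_mul, mul_assoc, RCLike.conj_mul]
      push_cast
      have : ((‖f (T x)‖ : ℝ) : 𝕜) ≠ 0 := by simpa using h0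
      field_simp
    rw [h2, RCLike.ofReal_re] at h1
    rwa [le_div_iff₀ hε, mul_comm]
  have hnot := hcon _ hbdd
  simp only [UnboundedNearZero] at hnot
  push Not at hnot
  obtain ⟨O, hO, c, hOc⟩ := hnot
  set c' : ℝ := max c 1
  have hc'0 : 0 < c' := lt_max_of_lt_right one_pos
  have hcont : Continuous fun y : F ↦ (c' : 𝕜) • y := by fun_prop
  have hopen : IsOpen ((fun y : F ↦ (c' : 𝕜) • y) ⁻¹' interior O) :=
    isOpen_interior.preimage hcont
  refine ⟨_, hopen.mem_nhds (by simpa using mem_interior_iff_mem_nhds.2 hO), ?_⟩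
  rw [inter_comm]
  refine hopen.inter_closure.trans (closure_minimal ?_ isClosed_closure)
  refine Subset.trans ?_ (closure_mono (image_mono hUU'))
  rintro _ ⟨hxO, x, rfl⟩
  by_contra hx
  have hV : Convex ℝ (closure (T '' U')) :=
    (hconv.linear_image (T.toLinearMap.restrictScalars ℝ)).closure
  obtain ⟨f, u, hfu, huf⟩ := RCLike.geometric_hahn_banach_closed_point (𝕜 := 𝕜) hV
    isClosed_closure hx
  have hu : 0 < u := by
    simpa using hfu 0 (subset_closure ⟨0, mem_of_mem_nhds hU', map_zero T⟩)
  have hg : ((u⁻¹ : ℝ) : 𝕜) • f ∈ {f : StrongDual 𝕜 F | ∀ x ∈ U', RCLike.re (f (T x)) ≤ 1} := by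
    intro x hx
    have := hfu (T x) (subset_closure ⟨x, hx, rfl⟩)
    rw [smul_apply, smul_eq_mul, RCLike.re_ofReal_mul, inv_mul_le_iff₀ hu]
    linarith
  have h1 := hOc ((c' : 𝕜) • T x) (T.range.smul_mem _ ⟨x, rfl⟩) (interior_subset hxO) _ hg
  have h2 := (RCLike.re_le_norm _).trans h1
  rw [map_smul, smul_eq_mul, smul_apply, smul_eq_mul, RCLike.re_ofReal_mul,
    RCLike.re_ofReal_mul] at h2
  have h3 : 1 < u⁻¹ * RCLike.re (f (T x)) := by rwa [lt_inv_mul_iff₀ hu, mul_one]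
  have h4 := mul_lt_mul_of_pos_left h3 hc'0
  linarith [le_max_left c 1]

/-- A subspace on which some pointwise bounded set of functionals is not equicontinuous meets
some closed infinite-dimensional subspace only at zero. -/
theorem UnboundedNearZero.exists_isClosed_disjoint [CompleteSpace F]
    {A : Set (StrongDual 𝕜 F)} {R : Submodule 𝕜 F} (h : UnboundedNearZero A R)
    (hA : ∀ y ∈ R, ∃ c, ∀ f ∈ A, ‖f y‖ ≤ c) :
    ∃ M : Submodule 𝕜 F, IsClosed (M : Set F) ∧ ¬ FiniteDimensional 𝕜 M ∧ Disjoint M R := by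
  obtain ⟨u, hu, hsum⟩ := exists_antitone_basis_nhds_zero_summable (G := F)
  choose w hwR hwu φ hφA hφw using fun n : ℕ ↦ h (u n) (hu.mem n) n
  set Y := Submodule.span 𝕜 (range w)
  have hYR : Y ≤ R := Submodule.span_le.2 (range_subset_iff.2 hwR)
  have hY : UnboundedNearZero A Y := by
    intro O hO c
    obtain ⟨k, hk⟩ := hu.mem_iff.1 hO
    obtain ⟨l, hl⟩ := exists_nat_ge c
    refine ⟨w (max k l), Submodule.subset_span ⟨_, rfl⟩,
      hk (hu.antitone (le_max_left k l) (hwu _)), φ _, hφA _, lt_of_le_of_lt ?_ (hφw _)⟩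
    exact hl.trans (by exact_mod_cast le_max_right k l)
  have hsep : TopologicalSpace.IsSeparable (closure (Y : Set F)) :=
    ((countable_range w).isSeparable.span (R := 𝕜)).closure
  obtain ⟨g, hg⟩ := hsep.exists_seq_dual_separating (𝕜 := 𝕜)
  have hc' : ∀ y, ∃ c : ℝ, 0 ≤ c ∧ (y ∈ R → ∀ f ∈ A, ‖f y‖ ≤ c) := by
    intro y
    by_cases hy : y ∈ R
    · obtain ⟨c, hc⟩ := hA y hy
      exact ⟨c, (norm_nonneg _).trans (hc _ (hφA 0)), fun _ ↦ hc⟩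
    · exact ⟨0, le_rfl, fun h ↦ absurd h hy⟩
  choose c hc0 hc using hc'
  obtain ⟨s, hs⟩ := exists_seq_of_forall_fin
    (fun n (t : Fin n → F × StrongDual 𝕜 F) a ↦ a.1 ∈ Y ∧ a.1 ∈ u n ∧
      (∀ i, (t i).2 a.1 = 0) ∧ (∀ k ≤ n, g k a.1 = 0) ∧ a.2 ∈ A ∧
      (n + 1) * (1 + ∑ i, c (t i).1) < ‖a.2 a.1‖) (by
    intro n t
    obtain ⟨y, ⟨⟨hyY, hyt⟩, hyg⟩, hyu, f, hf, hfy⟩ :=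
      ((hY.inf_iInf_ker (fun y hy ↦ hA y (hYR hy)) Finset.univ fun i ↦ (t i).2).inf_iInf_ker
        (fun y hy ↦ hA y (hYR hy.1)) (Finset.range (n + 1)) g) (u n) (hu.mem n)
        ((n + 1) * (1 + ∑ i, c (t i).1))
    refine ⟨(y, f), hyY, hyu, ?_, ?_, hf, hfy⟩
    · simpa using hyt
    · simpa [Nat.lt_succ_iff] using hyg)
  choose hyY hyu hfy hgy hfA hbig using hs
  set y : ℕ → F := fun n ↦ (s n).1
  set f : ℕ → StrongDual 𝕜 F := fun n ↦ (s n).2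
  have hσ : ∀ n, 0 ≤ ∑ i ∈ Finset.range n, c (y i) := fun n ↦ Finset.sum_nonneg fun i _ ↦ hc0 _
  have hbig' : ∀ n : ℕ, (n + 1) * (1 + ∑ i ∈ Finset.range n, c (y i)) < ‖f n (y n)‖ := by
    intro n
    rw [Finset.sum_range]
    exact hbig n
  obtain ⟨b, hb, hfb⟩ := exists_biorthogonal_of_triangular y f
    (fun n m hnm ↦ hfy m ⟨n, hnm⟩)
    (fun n ↦ norm_pos_iff.1 (lt_of_le_of_lt (by have := hσ n; positivity) (hbig' n)))
  have hys : Summable y := hsum y hyu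
  set N : ℕ → Set ℕ := fun j ↦ {n | n.unpair.1 = j}
  set z : ℕ → F := fun j ↦ ∑' n, (N j).indicator y n
  have hz : ∀ j, HasSum ((N j).indicator y) (z j) := fun j ↦ (hys.indicator (N j)).hasSum
  have hbz : ∀ n j, b n (z j) = if n.unpair.1 = j then 1 else 0 := by
    intro n j
    have h1 := (hz j).mapL (b n)
    have h2 : HasSum (fun m ↦ b n ((N j).indicator y m)) (b n ((N j).indicator y n)) := by
      refine hasSum_single n fun m hm ↦ ?_
      by_cases hmj : m ∈ N j
      · rw [indicator_of_mem hmj, hb, if_neg hm.symm]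
      · rw [indicator_of_notMem hmj, map_zero]
    rw [h1.unique h2]
    by_cases hnj : n ∈ N j
    · rw [indicator_of_mem hnj, hb, if_pos rfl]; exact (if_pos hnj).symm
    · rw [indicator_of_notMem hnj, map_zero]; exact (if_neg hnj).symm
  set S := (Submodule.span 𝕜 (range y)).topologicalClosure
  have hSY : S ≤ Y.topologicalClosure :=
    Submodule.topologicalClosure_mono (Submodule.span_le.2 (range_subset_iff.2 hyY))
  have hzS : ∀ j, z j ∈ S := by
    intro j
    refine (Submodule.isClosed_topologicalClosure _).mem_of_tendsto (hz j)
      (Eventually.of_forall fun t ↦ S.sum_mem fun i _ ↦ ?_)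
    by_cases hi : i ∈ N j
    · rw [indicator_of_mem hi]
      exact Submodule.le_topologicalClosure _ (Submodule.subset_span ⟨i, rfl⟩)
    · rw [indicator_of_notMem hi]
      exact S.zero_mem
  set M := (Submodule.span 𝕜 (range z)).topologicalClosure
  have hMS : M ≤ S := Submodule.topologicalClosure_minimal _
    (Submodule.span_le.2 (range_subset_iff.2 hzS)) (Submodule.isClosed_topologicalClosure _)
  have hblock : ∀ n m, n.unpair.1 = m.unpair.1 → ∀ x ∈ M, b n x = b m x := by
    intro n m hnm x hx
    have : M ≤ (b n - b m).ker := Submodule.topologicalClosure_minimal _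
      (Submodule.span_le.2 (range_subset_iff.2 fun j ↦ by simp [hbz, hnm])) (b n - b m).isClosed_ker
    simpa [sub_eq_zero] using this hx
  have hgb : ∀ k, ∀ x ∈ S, g k x = ∑ m ∈ Finset.range k, g k (y m) * b m x := by
    intro k x hx
    have : S ≤ (g k - ∑ m ∈ Finset.range k, g k (y m) • b m).ker := by
      refine Submodule.topologicalClosure_minimal _
        (Submodule.span_le.2 (range_subset_iff.2 fun j ↦ ?_)) (ContinuousLinearMap.isClosed_ker _)
      by_cases hj : j < k
      · simp [hb, hj]
      · have : g k (y j) = 0 := hgy j k (not_lt.1 hj)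
        simp [hb, hj, this]
    simpa [sub_eq_zero] using this hx
  have hinj : ∀ x ∈ M, (∀ n, b n x = 0) → x = 0 := by
    intro x hx h0
    refine hg x (hSY (hMS hx)) fun k ↦ ?_
    simp [hgb k x (hMS hx), h0]
  refine ⟨M, Submodule.isClosed_topologicalClosure _, fun hfin ↦ ?_, ?_⟩
  · have hli : LinearIndependent 𝕜 z := by
      rw [linearIndependent_iff']
      intro t a hta j hj
      have := congrArg (b (Nat.pair j 0)) hta
      simpa [hbz, hj] using this
    have hliM : LinearIndependent 𝕜 (fun j ↦ (⟨z j, Submodule.le_topologicalClosure _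
        (Submodule.subset_span ⟨j, rfl⟩)⟩ : M)) := LinearIndependent.of_comp M.subtype hli
    exact (hliM.finite_of_isNoetherian).false
  · rw [Submodule.disjoint_def]
    intro x hxM hxR
    have hbd : ∀ n : ℕ, ‖b n x‖ ≤ c x / (n + 1) := by
      intro n
      induction n using Nat.strong_induction_on with
      | h n ih =>
        have h1 : ‖f n (y n) * b n x‖ ≤ c x + ∑ m ∈ Finset.range n, c (y m) * c x := by
          rw [← sub_eq_of_eq_add' (hfb n x)]
          refine (norm_sub_le _ _).trans (add_le_add (hc x hxR _ (hfA n))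
            ((norm_sum_le _ _).trans (Finset.sum_le_sum fun m hm ↦ ?_)))
          rw [norm_mul]
          refine mul_le_mul (hc _ (hYR (hyY m)) _ (hfA n))
            ((ih m (Finset.mem_range.1 hm)).trans (div_le_self (hc0 x) (by simp)))
            (norm_nonneg _) (hc0 _)
        rw [← Finset.sum_mul, norm_mul] at h1
        have h2 := mul_le_mul_of_nonneg_right (hbig' n).le (norm_nonneg (b n x))
        have h3 : 0 < 1 + ∑ i ∈ Finset.range n, c (y i) := by linarith [hσ n]
        rw [le_div_iff₀ (by positivity)]
        refine le_of_mul_le_mul_left ?_ h3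
        linarith
    refine hinj x hxM fun n ↦ ?_
    have hlim : Tendsto (fun k : ℕ ↦ c x / ((k : ℝ) + 1)) atTop (𝓝 0) := by
      simpa [div_eq_mul_inv] using
        (tendsto_one_div_add_atTop_nhds_zero_nat (𝕜 := ℝ)).const_mul (c x)
    refine norm_le_zero_iff.1 (ge_of_tendsto' hlim fun k ↦ ?_)
    rw [hblock n (Nat.pair n.unpair.1 k) (by simp) x hxM]
    refine (hbd _).trans (div_le_div_of_nonneg_left (hc0 x) (by positivity) ?_)
    have : (k : ℝ) ≤ (Nat.pair n.unpair.1 k : ℕ) := by exact_mod_cast Nat.right_le_pair _ _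
    linarith

end Frechet

/-- **Drewnowski's theorem** (Theorem 2.4 of the paper): if `T : E → F` is a continuous
linear operator between Fréchet spaces whose range is not closed, then there is a closed
infinite-dimensional subspace `M` of `F` meeting the range only at `0`; in particular
`M \ {0}` lies in the complement of the range. -/
theorem drewnowski (𝕜 : Type*) [RCLike 𝕜] (E F : Type*)
    [AddCommGroup E] [Module 𝕜 E] [UniformSpace E] [IsUniformAddGroup E]
    [ContinuousSMul 𝕜 E] [CompleteSpace E] [TopologicalSpace.MetrizableSpace E]
    [Module ℝ E] [IsScalarTower ℝ 𝕜 E] [LocallyConvexSpace ℝ E]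
    [AddCommGroup F] [Module 𝕜 F] [UniformSpace F] [IsUniformAddGroup F]
    [ContinuousSMul 𝕜 F] [CompleteSpace F] [TopologicalSpace.MetrizableSpace F]
    [Module ℝ F] [IsScalarTower ℝ 𝕜 F] [LocallyConvexSpace ℝ F]
    (T : E →L[𝕜] F)
    (h : ¬ IsClosed (Set.range T : Set F)) :
    ∃ M : Submodule 𝕜 F, IsClosed (M : Set F) ∧ ¬ FiniteDimensional 𝕜 M ∧
      (M : Set F) ∩ Set.range T = {0} ∧
      (M : Set F) \ {0} ⊆ Set.univ \ Set.range T := by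
  obtain ⟨A, hA, hAT⟩ := T.exists_unboundedNearZero_range h
  obtain ⟨M, hM, hfin, hdisj⟩ := hAT.exists_isClosed_disjoint hA
  have hzero : ∀ x ∈ M, x ∈ Set.range T → x = 0 := fun x hxM hxT ↦
    Submodule.disjoint_def.1 hdisj x hxM hxT
  refine ⟨M, hM, hfin, ?_, fun x hx ↦ ⟨Set.mem_univ x, fun hxT ↦ hx.2 (hzero x hx.1 hxT)⟩⟩
  ext x
  refine ⟨fun hx ↦ hzero x hx.1 hx.2, ?_⟩
  rintro rfl
  exact ⟨M.zero_mem, 0, map_zero T⟩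
end

section
/- Let X be a Fréchet space, let (Z_n)_{n ∈ ℕ} be a countable family of Fréchet spaces, and for each n let T_n : Z_n → X be a continuous linear operator. Let Y := span(⋃_{n ∈ ℕ} T_n(Z_n)). If Y is not closed in X, then X \ Y is spaceable, i.e., there exists a closed infinite-dimensional linear subspace F of X with F ∩ Y = {0}. -/
section FrechetRanges

open Filter Topology Set Pointwise

/-- A set of continuous functionals is uniformly bounded by `1` on some neighbourhood of zero. -/
def UnifBddNearZero {𝕜 X : Type*} [RCLike 𝕜] [AddCommGroup X] [Module 𝕜 X] [TopologicalSpace X]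
    (D : Set (X →L[𝕜] 𝕜)) : Prop :=
  ∃ V ∈ 𝓝 (0 : X), ∀ f ∈ D, ∀ y ∈ V, ‖f y‖ ≤ 1

/-- The functionals bounded by `1` on `A` and vanishing on `s`. -/
def polarAnnihilator (𝕜 : Type*) {X : Type*} [RCLike 𝕜] [AddCommGroup X] [Module 𝕜 X]
    [TopologicalSpace X] (A s : Set X) : Set (X →L[𝕜] 𝕜) :=
  {f | (∀ a ∈ A, ‖f a‖ ≤ 1) ∧ ∀ g ∈ s, f g = 0}

section Functionals

variable {𝕜 X : Type*} [RCLike 𝕜] [AddCommGroup X] [Module 𝕜 X] [TopologicalSpace X]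
  [IsTopologicalAddGroup X] [ContinuousSMul 𝕜 X]

omit [IsTopologicalAddGroup X] in
theorem smul_preimage_mem_nhds_zero (c : 𝕜) {V : Set X} (hV : V ∈ 𝓝 (0 : X)) :
    {y | c • y ∈ V} ∈ 𝓝 (0 : X) := by
  have h : Tendsto (fun y : X => c • y) (𝓝 0) (𝓝 0) := by
    simpa using (continuous_const_smul c).tendsto (0 : X)
  exact h hV

omit [IsTopologicalAddGroup X] [ContinuousSMul 𝕜 X] in
theorem norm_apply_le_mem_nhds_zero (f : X →L[𝕜] 𝕜) {r : ℝ} (hr : 0 < r) :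
    {y | ‖f y‖ ≤ r} ∈ 𝓝 (0 : X) := by
  have h : Tendsto (fun y : X => ‖f y‖) (𝓝 0) (𝓝 0) := by
    simpa using f.continuous.norm.tendsto 0
  exact h (Iic_mem_nhds hr)

/-- Uniform boundedness near zero of a disked set of functionals, pointwise bounded on a dense set,
can be tested on the functionals vanishing at a given vector. -/
theorem UnifBddNearZero.of_inter_apply_eq_zero {D : Set (X →L[𝕜] 𝕜)}
    (hD : ∀ f ∈ D, ∀ h ∈ D, ∀ a b : 𝕜, ‖a‖ + ‖b‖ ≤ 1 → a • f + b • h ∈ D)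
    {S : Set X} (hS : Dense S) (hbdd : ∀ x ∈ S, ∃ M : ℝ, ∀ f ∈ D, ‖f x‖ ≤ M) (g : X)
    (hg : UnifBddNearZero (D ∩ {f | f g = 0})) : UnifBddNearZero D := by
  obtain ⟨V, hV, hVD⟩ := hg
  have hVD' : ∀ f ∈ D, f g = 0 → ∀ y ∈ V, ‖f y‖ ≤ 1 := fun f hf h0 => hVD f ⟨hf, h0⟩
  by_cases hM : ∃ M : ℝ, ∀ f ∈ D, ‖f g‖ ≤ M
  · obtain ⟨M, hM⟩ := hM
    by_cases h0 : ∀ f ∈ D, f g = 0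
    · exact ⟨V, hV, fun f hf => hVD' f hf (h0 f hf)⟩
    push Not at h0
    obtain ⟨h, hh, hhg⟩ := h0
    have hpos : 0 < ‖h g‖ := norm_pos_iff.2 hhg
    obtain ⟨R, hR⟩ : ∃ R : ℝ, R = M / ‖h g‖ := ⟨_, rfl⟩
    have hR0 : 0 ≤ R := by
      rw [hR]; exact div_nonneg ((norm_nonneg _).trans (hM h hh)) hpos.le
    have hc : ‖((1 + R : ℝ) : 𝕜)‖ = 1 + R := by
      rw [RCLike.norm_ofReal, abs_of_nonneg (by linarith)]
    have hc0 : ((1 + R : ℝ) : 𝕜) ≠ 0 := by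
      rw [← norm_pos_iff, hc]; linarith
    refine ⟨{y | ((2 * (1 + R) : ℝ) : 𝕜) • y ∈ V} ∩ {y | ‖h y‖ ≤ 1 / (2 * (1 + R))},
      inter_mem (smul_preimage_mem_nhds_zero _ hV)
        (norm_apply_le_mem_nhds_zero h (by positivity)), ?_⟩
    rintro f hf y ⟨hyV, hyh⟩
    set r : 𝕜 := f g / h g with hr
    have hrR : ‖r‖ ≤ R := by
      rw [hr, hR, norm_div]; gcongr; exact hM f hf
    have hk := hD f hf h hh ((1 + R : ℝ) : 𝕜)⁻¹ (-((1 + R : ℝ) : 𝕜)⁻¹ * r) (by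
      rw [norm_mul, norm_neg, norm_inv, hc, ← mul_one_add]
      rw [inv_mul_le_one₀ (by linarith)]
      linarith)
    have hk0 := hVD' _ hk (by
      simp only [add_apply, smul_apply, smul_eq_mul, hr]
      field_simp
      ring) _ hyV
    have e : f y = (1 / 2 : 𝕜) * ((((1 + R : ℝ) : 𝕜)⁻¹ • f +
        (-((1 + R : ℝ) : 𝕜)⁻¹ * r) • h) (((2 * (1 + R) : ℝ) : 𝕜) • y)) + r * h y := by
      simp only [add_apply, smul_apply, smul_eq_mul,
        map_smul]
      rw [RCLike.ofReal_mul]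
      field_simp
      push_cast
      ring
    rw [e]
    refine (norm_add_le _ _).trans ?_
    rw [norm_mul, norm_mul]
    have h1 : ‖r‖ * ‖h y‖ ≤ R * (1 / (2 * (1 + R))) := by
      gcongr
      exact hyh
    have h2 : R * (1 / (2 * (1 + R))) ≤ 1 / 2 := by
      rw [mul_one_div, div_le_div_iff₀ (by positivity) (by positivity)]
      linarith
    have h3 : ‖(1 / 2 : 𝕜)‖ = 1 / 2 := by simp
    rw [h3]
    linarith
  · exfalso
    push Not at hM
    obtain ⟨f₀, hf₀, hf₀g⟩ := hM 1
    have hf₀0 : f₀ g ≠ 0 := norm_pos_iff.1 (by linarith)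
    obtain ⟨x, hxS, hxV, hxf⟩ : ∃ x ∈ S, (8 : 𝕜) • (g - x) ∈ V ∧ ‖f₀ (g - x)‖ ≤ 1 / 4 := by
      have hN : {y : X | (8 : 𝕜) • y ∈ V} ∩ {y | ‖f₀ y‖ ≤ 1 / 4} ∈ 𝓝 (0 : X) :=
        inter_mem (smul_preimage_mem_nhds_zero _ hV)
          (norm_apply_le_mem_nhds_zero f₀ (by positivity))
      have ht : Tendsto (fun x : X => g - x) (𝓝 g) (𝓝 0) := by
        simpa only [sub_self, id] using tendsto_const_nhds.sub (tendsto_id (x := 𝓝 g)) (a := g)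
      obtain ⟨x, hx, hxS⟩ := mem_closure_iff_nhds.1 (hS g) _ (ht hN)
      exact ⟨x, hxS, hx⟩
    obtain ⟨M, hMx⟩ := hbdd x hxS
    obtain ⟨f, hf, hfg⟩ := hM (max 1 (4 * M))
    have hfg1 : 1 < ‖f g‖ := (le_max_left _ _).trans_lt hfg
    have hfg2 : 4 * M < ‖f g‖ := (le_max_right _ _).trans_lt hfg
    have hf0 : f g ≠ 0 := norm_pos_iff.1 (by linarith)
    have hk := hD f hf f₀ hf₀ ((1 / 2) / f g) (-((1 / 2) / f₀ g)) (by
      rw [norm_neg, norm_div _ (f g), norm_div _ (f₀ g)]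
      have h3 : ‖(1 / 2 : 𝕜)‖ = 1 / 2 := by simp
      rw [h3]
      have h4 : 1 / 2 / ‖f g‖ ≤ 1 / 2 := div_le_self (by norm_num) hfg1.le
      have h5 : 1 / 2 / ‖f₀ g‖ ≤ 1 / 2 := div_le_self (by norm_num) hf₀g.le
      linarith)
    have hk0 := hVD' _ hk (by
      simp only [add_apply, smul_apply, smul_eq_mul]
      field_simp
      ring) _ hxV
    have e : (1 : 𝕜) = (1 / 4) * (((1 / 2) / f g) • f + (-((1 / 2) / f₀ g)) • f₀)
        ((8 : 𝕜) • (g - x)) + f₀ (g - x) / f₀ g + f x / f g := by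
      simp only [add_apply, smul_apply, smul_eq_mul,
        map_smul, map_sub]
      field_simp
      ring
    have h1 : ‖(1 / 4 : 𝕜)‖ = 1 / 4 := by simp
    have h2 : ‖f₀ (g - x) / f₀ g‖ ≤ 1 / 4 := by
      rw [norm_div]
      exact (div_le_self (norm_nonneg _) hf₀g.le).trans hxf
    have h3 : ‖f x / f g‖ ≤ 1 / 4 := by
      rw [norm_div, div_le_iff₀ (by linarith)]
      linarith [hMx f hf]
    have h4 := congrArg norm e
    rw [norm_one] at h4
    have h5 := norm_add₃_le (a := (1 / 4 : 𝕜) * (((1 / 2) / f g) • f + (-((1 / 2) / f₀ g)) • f₀)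
        ((8 : 𝕜) • (g - x))) (b := f₀ (g - x) / f₀ g) (c := f x / f g)
    rw [← h4, norm_mul, h1] at h5
    linarith

theorem UnifBddNearZero.of_inter_annihilator {S : Set X} (hS : Dense S) (s : Finset X)
    {D : Set (X →L[𝕜] 𝕜)}
    (hD : ∀ f ∈ D, ∀ h ∈ D, ∀ a b : 𝕜, ‖a‖ + ‖b‖ ≤ 1 → a • f + b • h ∈ D)
    (hbdd : ∀ x ∈ S, ∃ M : ℝ, ∀ f ∈ D, ‖f x‖ ≤ M)
    (hs : UnifBddNearZero (D ∩ {f | ∀ g ∈ s, f g = 0})) : UnifBddNearZero D := by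
  classical
  induction s using Finset.induction_on with
  | empty => simpa using hs
  | insert g s _ ih =>
    refine ih (UnifBddNearZero.of_inter_apply_eq_zero ?_ hS ?_ g ?_)
    · rintro f ⟨hf, hfs⟩ h ⟨hh, hhs⟩ a b hab
      refine ⟨hD f hf h hh a b hab, fun g hg => ?_⟩
      simp [hfs g hg, hhs g hg]
    · intro x hx
      obtain ⟨M, hM⟩ := hbdd x hx
      exact ⟨M, fun f hf => hM f hf.1⟩
    · obtain ⟨V, hV, h⟩ := hs
      refine ⟨V, hV, fun f hf => h f ⟨hf.1.1, ?_⟩⟩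
      intro a ha
      rcases Finset.mem_insert.1 ha with rfl | ha
      · exact hf.2
      · exact hf.1.2 a ha

omit [IsTopologicalAddGroup X] [ContinuousSMul 𝕜 X] in
theorem polarAnnihilator_combination_mem {A s : Set X} :
    ∀ f ∈ polarAnnihilator 𝕜 A s, ∀ h ∈ polarAnnihilator 𝕜 A s, ∀ a b : 𝕜, ‖a‖ + ‖b‖ ≤ 1 →
      a • f + b • h ∈ polarAnnihilator 𝕜 A s := by
  rintro f ⟨hf, hfs⟩ h ⟨hh, hhs⟩ a b hab
  refine ⟨fun x hx => ?_, fun g hg => by simp [hfs g hg, hhs g hg]⟩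
  have h1 := norm_add_le (a * f x) (b * h x)
  rw [norm_mul, norm_mul] at h1
  have h2 := mul_le_of_le_one_right (norm_nonneg a) (hf x hx)
  have h3 := mul_le_of_le_one_right (norm_nonneg b) (hh x hx)
  simp only [add_apply, smul_apply, smul_eq_mul]
  linarith

variable [Module ℝ X] [IsScalarTower ℝ 𝕜 X] [LocallyConvexSpace ℝ X]

theorem exists_norm_le_one_of_notMem_closure {A : Set X} (hc : Convex ℝ A) (hb : Balanced 𝕜 A)
    (hne : A.Nonempty) {x : X} (hx : x ∉ closure A) :
    ∃ f : X →L[𝕜] 𝕜, (∀ a ∈ A, ‖f a‖ ≤ 1) ∧ 1 < ‖f x‖ := by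
  have : ContinuousSMul ℝ X := IsScalarTower.continuousSMul 𝕜
  obtain ⟨f, u, hu, hux⟩ :=
    RCLike.geometric_hahn_banach_closed_point (𝕜 := 𝕜) hc.closure isClosed_closure hx
  have hu0 : 0 < u := by
    simpa using hu 0 (subset_closure (hb.zero_mem hne))
  have hc' : ‖((u⁻¹ : ℝ) : 𝕜)‖ = u⁻¹ := by
    rw [RCLike.norm_ofReal, abs_of_pos (inv_pos.2 hu0)]
  refine ⟨((u⁻¹ : ℝ) : 𝕜) • f, fun a ha => ?_, ?_⟩
  · obtain ⟨c, hc1, hca⟩ := RCLike.exists_norm_eq_mul_self (f a)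
    have h1 := hu (c • a) (subset_closure (hb.smul_mem hc1.le ha))
    rw [map_smul, smul_eq_mul, ← hca, RCLike.ofReal_re] at h1
    rw [smul_apply, norm_smul, hc', inv_mul_le_one₀ hu0]
    exact h1.le
  · rw [smul_apply, norm_smul, hc', ← div_eq_inv_mul, one_lt_div hu0]
    exact hux.trans_le (RCLike.re_le_norm _)

theorem UnifBddNearZero.closure_mem_nhds {A s : Set X} (hc : Convex ℝ A) (hb : Balanced 𝕜 A)
    (hne : A.Nonempty) (hs : ∀ f : X →L[𝕜] 𝕜, (∀ a ∈ A, ‖f a‖ ≤ 1) → ∀ g ∈ s, f g = 0)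
    (h : UnifBddNearZero (polarAnnihilator 𝕜 A s)) : closure A ∈ 𝓝 (0 : X) := by
  obtain ⟨V, hV, hVA⟩ := h
  refine mem_of_superset hV fun x hx => ?_
  by_contra hxA
  obtain ⟨f, hf, hfx⟩ := exists_norm_le_one_of_notMem_closure hc hb hne hxA
  exact absurd (hVA f ⟨hf, hs f hf⟩ x hx) (not_le.2 hfx)

omit [IsTopologicalAddGroup X] in
theorem exists_convex_balanced_subset {U : Set X} (hU : U ∈ 𝓝 (0 : X)) :
    ∃ V ∈ 𝓝 (0 : X), Convex ℝ V ∧ Balanced 𝕜 V ∧ V ⊆ U := by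
  have : ContinuousSMul ℝ X := IsScalarTower.continuousSMul 𝕜
  obtain ⟨C, ⟨hC, hCc⟩, hCU⟩ :=
    (LocallyConvexSpace.convex_basis_zero ℝ X).mem_iff.1 hU
  refine ⟨convexHull ℝ (balancedCore 𝕜 C),
    mem_of_superset (balancedCore_mem_nhds_zero hC) (subset_convexHull ℝ _),
    convex_convexHull ℝ _, ?_,
    (convexHull_min (balancedCore_subset C) hCc).trans hCU⟩
  rw [balanced_iff_smul_mem]
  intro a ha x hx
  have : Convex ℝ {x : X | a • x ∈ convexHull ℝ (balancedCore 𝕜 C)} := by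
    have h := (convex_convexHull ℝ (balancedCore 𝕜 C)).linear_preimage
      ((a • (LinearMap.id : X →ₗ[𝕜] X)).restrictScalars ℝ)
    exact h
  exact convexHull_min (fun y hy => show a • y ∈ convexHull ℝ (balancedCore 𝕜 C) from
    subset_convexHull ℝ _
    ((balancedCore_balanced C).smul_mem ha hy)) this hx

end Functionals

section Sums

theorem sum_mem_of_add_subset {G : Type*} [AddCommGroup G] {u : ℕ → Set G} (hu : Antitone u)
    (h0 : ∀ n, (0 : G) ∈ u n) (hadd : ∀ n, u (n + 1) + u (n + 1) ⊆ u n) {w : ℕ → G}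
    (hw : ∀ n, w n ∈ u n) (t : Finset ℕ) : ∀ N, (∀ i ∈ t, N < i) → ∑ i ∈ t, w i ∈ u N := by
  induction t using Finset.induction_on_min with
  | empty => simpa using h0
  | insert a t hat ih =>
    intro N hN
    rw [Finset.sum_insert fun h => (hat a h).false]
    obtain ⟨b, rfl⟩ : ∃ b, a = b + 1 :=
      Nat.exists_eq_succ_of_ne_zero (by have := hN a (Finset.mem_insert_self _ _); lia)
    have hNb : N ≤ b := Nat.lt_succ_iff.1 (hN _ (Finset.mem_insert_self _ _))
    exact hu hNb (hadd b (Set.add_mem_add (hw _) (ih _ hat)))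

theorem summable_of_add_subset {G : Type*} [AddCommGroup G] [UniformSpace G] [IsUniformAddGroup G]
    [CompleteSpace G] {u : ℕ → Set G} (hu : (𝓝 (0 : G)).HasAntitoneBasis u)
    (hadd : ∀ n, u (n + 1) + u (n + 1) ⊆ u n) {w : ℕ → G} (hw : ∀ n, w n ∈ u n) :
    Summable w := by
  rw [summable_iff_cauchySeq_finset, cauchySeq_finset_iff_sum_vanishing]
  intro e he
  obtain ⟨N, -, hN⟩ := hu.1.mem_iff.1 he
  refine ⟨Finset.range (N + 1), fun t ht => hN ?_⟩
  refine sum_mem_of_add_subset hu.2 (fun n => mem_of_mem_nhds (hu.mem n)) hadd hw t N fun i hi => ?_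
  have := Finset.disjoint_left.1 ht hi
  simp only [Finset.mem_range] at this
  lia

end Sums

theorem Submodule.locallyConvexSpace_real {𝕜 X : Type*} [RCLike 𝕜] [AddCommGroup X] [Module 𝕜 X]
    [TopologicalSpace X] [Module ℝ X] [IsScalarTower ℝ 𝕜 X] [LocallyConvexSpace ℝ X]
    (G : Submodule 𝕜 X) : LocallyConvexSpace ℝ G :=
  Topology.IsInducing.locallyConvexSpace (f := G.subtype.restrictScalars ℝ) .subtypeVal

section OpenMapping

variable {𝕜 W X : Type*} [RCLike 𝕜]
  [AddCommGroup W] [Module 𝕜 W] [UniformSpace W] [IsUniformAddGroup W] [ContinuousSMul 𝕜 W]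
  [CompleteSpace W] [FirstCountableTopology W]
  [AddCommGroup X] [Module 𝕜 X] [UniformSpace X] [IsUniformAddGroup X]
  [ContinuousSMul 𝕜 X] [T2Space X] [FirstCountableTopology X]

omit [ContinuousSMul 𝕜 W] in
/-- An almost open continuous linear map from a complete metrizable space is surjective. -/
theorem range_eq_top_of_closure_image_mem_nhds (S : W →L[𝕜] X)
    (hS : ∀ U ∈ 𝓝 (0 : W), closure (S '' U) ∈ 𝓝 (0 : X)) : S.range = ⊤ := by
  obtain ⟨u, hu, hadd⟩ := IsTopologicalAddGroup.exists_antitone_basis_nhds_zero W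
  obtain ⟨b, hb⟩ := (𝓝 (0 : X)).exists_antitone_basis
  have hstep : ∀ n, ∀ x ∈ closure (S '' u n), ∃ w ∈ u n,
      x - S w ∈ closure (S '' u (n + 1)) ∩ b n := by
    intro n x hx
    have hN : closure (S '' u (n + 1)) ∩ b n ∈ 𝓝 (0 : X) :=
      inter_mem (hS _ (hu.mem _)) (hb.mem n)
    have ht : Tendsto (fun y : X => x - y) (𝓝 x) (𝓝 0) := by
      simpa only [sub_self, id] using tendsto_const_nhds.sub (tendsto_id (x := 𝓝 x)) (a := x)
    obtain ⟨_, hy, w, hw, rfl⟩ := mem_closure_iff_nhds.1 hx _ (ht hN)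
    exact ⟨w, hw, hy⟩
  choose! w hwu hwx using hstep
  apply Submodule.eq_top_of_nonempty_interior'
  refine ⟨0, mem_interior_iff_mem_nhds.2 (mem_of_superset (hS _ (hu.mem 0)) fun x hx => ?_)⟩
  let r : ℕ → X := fun n => Nat.rec x (fun n y => y - S (w n y)) n
  have hr : ∀ n, r n ∈ closure (S '' u n) := by
    intro n
    induction n with
    | zero => exact hx
    | succ n ih => exact (hwx n _ ih).1
  have hsum : Summable fun n => w n (r n) :=
    summable_of_add_subset hu hadd fun n => hwu n _ (hr n)
  have hpart : ∀ n, x - S (∑ i ∈ Finset.range n, w i (r i)) = r n := by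
    intro n
    induction n with
    | zero => simp [r]
    | succ n ih =>
      rw [Finset.sum_range_succ, map_add, ← sub_sub, ih]
  have hr0 : Tendsto r atTop (𝓝 0) := by
    rw [← tendsto_add_atTop_iff_nat 1]
    refine hb.tendsto fun n => (hwx n _ (hr n)).2
  have hlim : Tendsto r atTop (𝓝 (x - S (∑' n, w n (r n)))) := by
    refine Tendsto.congr hpart (tendsto_const_nhds.sub ?_)
    exact (S.continuous.tendsto _).comp hsum.hasSum.tendsto_sum_nat
  exact ⟨_, (sub_eq_zero.1 (tendsto_nhds_unique hlim hr0)).symm⟩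

variable [Module ℝ W] [IsScalarTower ℝ 𝕜 W] [LocallyConvexSpace ℝ W]
  [Module ℝ X] [IsScalarTower ℝ 𝕜 X] [LocallyConvexSpace ℝ X]

/-- A continuous linear map with dense range whose image polars are equicontinuous up to
finitely many linear constraints is surjective. -/
theorem range_eq_top_of_unifBddNearZero (S : W →L[𝕜] X) (hd : Dense (S.range : Set X))
    (hS : ∀ U ∈ 𝓝 (0 : W), ∃ s : Finset X, UnifBddNearZero (polarAnnihilator 𝕜 (S '' U) s)) :
    S.range = ⊤ := by
  refine range_eq_top_of_closure_image_mem_nhds S fun U hU => ?_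
  obtain ⟨V, hV, hVc, hVb, hVU⟩ := exists_convex_balanced_subset (𝕜 := 𝕜) hU
  obtain ⟨s, hs⟩ := hS V hV
  have key : UnifBddNearZero (polarAnnihilator 𝕜 (S '' V) (∅ : Set X)) := by
    refine UnifBddNearZero.of_inter_annihilator hd s polarAnnihilator_combination_mem ?_ ?_
    · rintro _ ⟨w, rfl⟩
      obtain ⟨c, hc, hcw⟩ : ∃ c : 𝕜, c ≠ 0 ∧ c • w ∈ V := by
        have h := (absorbent_nhds_zero hV : Absorbent 𝕜 V).eventually_nhdsNE_zero w
        obtain ⟨c, hc, hc0⟩ := (h.and self_mem_nhdsWithin).exists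
        exact ⟨c, hc0, hc⟩
      refine ⟨1 / ‖c‖, fun f hf => ?_⟩
      rw [le_div_iff₀ (norm_pos_iff.2 hc), mul_comm, ← norm_mul, ← smul_eq_mul, ← map_smul]
      have := hf.1 _ (mem_image_of_mem S hcw)
      rwa [map_smul] at this
    · obtain ⟨N, hN, h⟩ := hs
      exact ⟨N, hN, fun f hf => h f ⟨hf.1.1, hf.2⟩⟩
  have hSV : closure (S '' V) ∈ 𝓝 (0 : X) := by
    refine key.closure_mem_nhds ?_ ?_ ⟨_, mem_image_of_mem S (mem_of_mem_nhds hV)⟩ (by simp)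
    · exact hVc.linear_image ((S : W →ₗ[𝕜] X).restrictScalars ℝ)
    · rw [balanced_iff_smul_mem] at hVb ⊢
      rintro a ha _ ⟨v, hv, rfl⟩
      exact ⟨a • v, hVb ha hv, map_smul S a v⟩
  exact mem_of_superset hSV (closure_mono (image_mono hVU))

omit [CompleteSpace W] [FirstCountableTopology W] [T2Space X] [FirstCountableTopology X]
  [ContinuousSMul 𝕜 W] [IsUniformAddGroup W] [Module ℝ W] [IsScalarTower ℝ 𝕜 W]
  [LocallyConvexSpace ℝ W] in
theorem dense_range_of_unifBddNearZero (S : W →L[𝕜] X)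
    (h : UnifBddNearZero (polarAnnihilator 𝕜 (S.range : Set X) ∅)) :
    Dense (S.range : Set X) := by
  have h1 : closure (S.range : Set X) ∈ 𝓝 (0 : X) := by
    refine h.closure_mem_nhds (S.range.restrictScalars ℝ).convex ?_ ⟨0, S.range.zero_mem⟩ (by simp)
    rw [balanced_iff_smul_mem]
    exact fun a _ x hx => S.range.smul_mem a hx
  rw [← Submodule.topologicalClosure_coe] at h1
  have h2 := Submodule.eq_top_of_nonempty_interior' _ ⟨0, mem_interior_iff_mem_nhds.2 h1⟩
  rw [← Submodule.dense_iff_topologicalClosure_eq_top] at h2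
  exact h2

/-- If the range of `S` lies in a proper subspace `Y`, some image `S '' U` of a neighbourhood of
zero has a polar that is not equicontinuous, even after imposing finitely many constraints
from `Y`. -/
theorem exists_nhds_not_unifBddNearZero (S : W →L[𝕜] X) {Y : Submodule 𝕜 X} (hSY : S.range ≤ Y)
    (hY : Y ≠ ⊤) : ∃ U ∈ 𝓝 (0 : W), ∀ s : Finset X, (s : Set X) ⊆ Y →
      ¬ UnifBddNearZero (polarAnnihilator 𝕜 (S '' U) s) := by
  by_contra! hcon
  obtain ⟨s, hsY, hs⟩ := hcon univ univ_mem
  let G : Submodule 𝕜 X := Submodule.span 𝕜 (s : Set X)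
  have : FiniteDimensional 𝕜 G := FiniteDimensional.span_finset 𝕜 s
  have : IsUniformAddGroup G := G.toAddSubgroup.isUniformAddGroup
  have : LocallyConvexSpace ℝ G := G.locallyConvexSpace_real
  have : FirstCountableTopology G := Topology.IsInducing.subtypeVal.firstCountableTopology
  have : CompleteSpace G := FiniteDimensional.complete 𝕜 G
  let R : W × G →L[𝕜] X := S.coprod G.subtypeL
  have hSR : ∀ w, S w = R (w, 0) := fun w => by simp [R]
  have hR : Dense (R.range : Set X) := by
    apply dense_range_of_unifBddNearZero
    obtain ⟨V, hV, h⟩ := hs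
    refine ⟨V, hV, fun f hf => h f ⟨?_, ?_⟩⟩
    · rintro _ ⟨w, -, rfl⟩
      exact hf.1 _ ⟨(w, 0), (hSR w).symm⟩
    · intro g hg
      have hgR : g ∈ R.range := ⟨(0, ⟨g, Submodule.subset_span hg⟩), by simp [R]⟩
      by_contra h0
      have h1 := hf.1 _ (R.range.smul_mem (2 / f g) hgR)
      rw [map_smul, smul_eq_mul, div_mul_cancel₀ _ h0, RCLike.norm_two] at h1
      norm_num at h1
  have htop := range_eq_top_of_unifBddNearZero R hR ?_
  · refine hY (top_le_iff.1 (htop.symm.le.trans ?_))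
    rintro _ ⟨⟨w, g⟩, rfl⟩
    have h1 : S w ∈ Y := hSY ⟨w, rfl⟩
    have h2 : (g : X) ∈ Y := Submodule.span_le.2 hsY g.2
    simpa [R] using Y.add_mem h1 h2
  · intro U hU
    have hU' : {w : W | (w, (0 : G)) ∈ U} ∈ 𝓝 (0 : W) :=
      (Continuous.prodMk_left (0 : G)).continuousAt.preimage_mem_nhds hU
    obtain ⟨t, -, V, hV, h⟩ := hcon _ hU'
    refine ⟨t, V, hV, fun f hf => h f ⟨?_, hf.2⟩⟩
    rintro _ ⟨w, hw, rfl⟩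
    rw [hSR]
    exact hf.1 _ ⟨_, hw, rfl⟩

end OpenMapping

section Sequence

/-- Recursive construction of a sequence, where the `n`-th point satisfies a predicate depending
on `n` and is related to all previous points. -/
theorem exists_seq_of_forall_nat_finset_exists {α : Type*} (P : ℕ → α → Prop) (r : α → α → Prop)
    (h : ∀ n, ∀ s : Finset α, (∀ x ∈ s, ∃ m, P m x) → ∃ y, P n y ∧ ∀ x ∈ s, r x y) :
    ∃ f : ℕ → α, (∀ n, P n (f n)) ∧ ∀ m n, m < n → r (f m) (f n) := by
  classical
  have : Nonempty α := (h 0 ∅ (by simp)).nonempty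
  choose! F hF using h
  let f : ℕ → α := fun n => Nat.strongRec
    (fun n ih => F n (Finset.univ.image fun i : Fin n => ih i i.2)) n
  have hf : ∀ n, f n = F n (Finset.univ.image fun i : Fin n => f i) := fun n => by
    simp only [f]
    rw [Nat.strongRec_eq]
  have hP : ∀ n, P n (f n) := by
    intro n
    induction n using Nat.strong_induction_on with
    | _ n ih =>
      rw [hf]
      refine (hF n _ fun x hx => ?_).1
      obtain ⟨i, -, rfl⟩ := Finset.mem_image.1 hx
      exact ⟨i, ih i i.2⟩
  refine ⟨f, hP, fun m n hmn => ?_⟩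
  rw [hf n]
  refine (hF n _ fun x hx => ?_).2 _ (Finset.mem_image.2 ⟨⟨m, hmn⟩, Finset.mem_univ _, rfl⟩)
  obtain ⟨i, -, rfl⟩ := Finset.mem_image.1 hx
  exact ⟨i, hP i⟩

end Sequence

section Step

variable {𝕜 X : Type*} [RCLike 𝕜] [AddCommGroup X] [Module 𝕜 X] [TopologicalSpace X]
  [IsTopologicalAddGroup X] [ContinuousSMul 𝕜 X]

/-- Given finitely many functionals, there is a continuous linear map into a dense subspace `Y`
which is preserved by those functionals, and which is controlled by finitely many vectors
of `Y`. -/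
theorem exists_finite_rank_correction {Y : Submodule 𝕜 X} (hY : Dense (Y : Set X))
    (Φ : Finset (X →L[𝕜] 𝕜)) : ∃ R : X →L[𝕜] X, ∃ t : Finset X, (t : Set X) ⊆ Y ∧
      (∀ x, R x ∈ Submodule.span 𝕜 (t : Set X)) ∧ ∀ φ ∈ Φ, ∀ x, φ (R x) = φ x := by
  classical
  let φ : X →L[𝕜] (Φ → 𝕜) := ContinuousLinearMap.pi fun i => i.1
  have hmap : Y.map (φ : X →ₗ[𝕜] (Φ → 𝕜)) = φ.range := by
    refine le_antisymm (LinearMap.map_le_range) ?_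
    rintro _ ⟨x, rfl⟩
    have hcl : IsClosed ((Y.map (φ : X →ₗ[𝕜] (Φ → 𝕜)) : Submodule 𝕜 (Φ → 𝕜)) : Set (Φ → 𝕜)) :=
      Submodule.closed_of_finiteDimensional _
    have hsub : (Y : Set X) ⊆ φ ⁻¹' (Y.map (φ : X →ₗ[𝕜] (Φ → 𝕜)) : Submodule 𝕜 (Φ → 𝕜)) :=
      fun y hy => Submodule.mem_map_of_mem hy
    exact closure_minimal hsub (hcl.preimage φ.continuous) (hY x)
  let q : Y →ₗ[𝕜] Y.map (φ : X →ₗ[𝕜] (Φ → 𝕜)) := (φ : X →ₗ[𝕜] (Φ → 𝕜)).submoduleMap Y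
  obtain ⟨ρ, hρ⟩ := q.exists_rightInverse_of_surjective
    (LinearMap.range_eq_top.2 ((φ : X →ₗ[𝕜] (Φ → 𝕜)).submoduleMap_surjective Y))
  let φ' : X →L[𝕜] Y.map (φ : X →ₗ[𝕜] (Φ → 𝕜)) := φ.codRestrict _ fun x => by
    rw [hmap]; exact ⟨x, rfl⟩
  let ρ' : Y.map (φ : X →ₗ[𝕜] (Φ → 𝕜)) →L[𝕜] X := LinearMap.toContinuousLinearMap (Y.subtype ∘ₗ ρ)
  obtain ⟨t, ht⟩ := Module.Finite.iff_fg.1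
    (inferInstance : Module.Finite 𝕜 (LinearMap.range (Y.subtype ∘ₗ ρ)))
  refine ⟨ρ' ∘L φ', t, ?_, ?_, ?_⟩
  · refine (Submodule.subset_span (R := 𝕜)).trans ?_
    rw [ht]
    rintro _ ⟨e, rfl⟩
    exact (ρ e).2
  · intro x
    rw [ht]
    exact ⟨φ' x, rfl⟩
  · intro ψ hψ x
    have h1 : q (ρ (φ' x)) = φ' x := LinearMap.congr_fun hρ (φ' x)
    exact congrFun (congrArg Subtype.val h1) ⟨ψ, hψ⟩

theorem exists_small_mem_large_apply {Y : Submodule 𝕜 X} (hY : Dense (Y : Set X)) {A : Set X}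
    (hA : ∀ s : Finset X, (s : Set X) ⊆ Y → ¬ UnifBddNearZero (polarAnnihilator 𝕜 A s))
    (Φ : Finset (X →L[𝕜] 𝕜)) {s : Finset X} (hs : (s : Set X) ⊆ Y) {V : Set X} (hV : V ∈ 𝓝 (0 : X))
    (C : ℝ) : ∃ u ∈ Y, u ∈ V ∧ (∀ φ ∈ Φ, φ u = 0) ∧
      ∃ f ∈ polarAnnihilator 𝕜 A (s : Set X), C < ‖f u‖ := by
  classical
  obtain ⟨R, t, htY, htR, hR⟩ := exists_finite_rank_correction hY Φ
  let P : X →L[𝕜] X := ContinuousLinearMap.id 𝕜 X - R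
  have hPx : ∀ x, P x = x - R x := fun x => rfl
  have hP : P ⁻¹' interior V ∈ 𝓝 (0 : X) :=
    P.continuous.continuousAt.preimage_mem_nhds (by
      rw [map_zero]; exact interior_mem_nhds.2 hV)
  have hbad := hA (s ∪ t) (by rw [Finset.coe_union]; exact union_subset hs htY)
  obtain ⟨c, hc⟩ : ∃ c : 𝕜, max C 1 = ‖c‖ := ⟨((max C 1 : ℝ) : 𝕜), by
    rw [RCLike.norm_ofReal, abs_of_nonneg (zero_le_one.trans (le_max_right _ _))]⟩
  simp only [UnifBddNearZero] at hbad
  push Not at hbad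
  obtain ⟨f, hf, y, hy, hfy⟩ := hbad _ (smul_preimage_mem_nhds_zero c hP)
  have hfR : ∀ x, f (R x) = 0 := by
    intro x
    have : Submodule.span 𝕜 (t : Set X) ≤ (f : X →ₗ[𝕜] 𝕜).ker :=
      Submodule.span_le.2 fun g hg => hf.2 g (by simp [show g ∈ t from hg])
    exact this (htR x)
  have hopen : IsOpen ({x | C < ‖f x‖} ∩ P ⁻¹' interior V) :=
    (isOpen_lt continuous_const f.continuous.norm).inter (isOpen_interior.preimage P.continuous)
  have hne : ({x | C < ‖f x‖} ∩ P ⁻¹' interior V).Nonempty := by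
    refine ⟨c • y, ?_, hy⟩
    rw [mem_ofPred_eq, map_smul, smul_eq_mul, norm_mul, ← hc]
    have h1 : 0 < max C 1 := lt_max_of_lt_right one_pos
    exact (le_max_left C 1).trans_lt (lt_mul_of_one_lt_right h1 hfy)
  obtain ⟨z, ⟨hz1, hz2⟩, hzY⟩ := hY.exists_mem_open hopen hne |>.imp fun z h => h.symm
  refine ⟨P z, ?_, interior_subset hz2, ?_, f,
    ⟨hf.1, fun g hg => hf.2 g (by simp [show g ∈ s from hg])⟩, ?_⟩
  · exact Y.sub_mem hzY (Submodule.span_le.2 htY (htR z))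
  · intro φ hφ
    rw [hPx, map_sub, hR φ hφ, sub_self]
  · rw [hPx, map_sub, hfR, sub_zero]
    exact hz1

end Step

section Total

theorem exists_seq_apply_eq_zero_imp_eq_zero (𝕜 X : Type*) [RCLike 𝕜] [AddCommGroup X] [Module 𝕜 X]
    [TopologicalSpace X] [IsTopologicalAddGroup X] [ContinuousSMul 𝕜 X] [T2Space X]
    [SecondCountableTopology X] [Module ℝ X] [IsScalarTower ℝ 𝕜 X] [LocallyConvexSpace ℝ X] :
    ∃ g : ℕ → X →L[𝕜] 𝕜, ∀ x, (∀ k, g k x = 0) → x = 0 := by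
  obtain ⟨T, hT, hTu⟩ := TopologicalSpace.isOpen_iUnion_countable
    (fun f : X →L[𝕜] 𝕜 => {x | f x ≠ 0}) fun f => isOpen_ne_fun f.continuous continuous_const
  obtain ⟨g, hg⟩ := (hT.insert 0).exists_eq_range (insert_nonempty _ _)
  refine ⟨g, fun x hx => ?_⟩
  by_contra hx0
  obtain ⟨f, -, hfx⟩ := exists_norm_le_one_of_notMem_closure (𝕜 := 𝕜) (A := {(0 : X)})
    (convex_singleton _) (by rw [balanced_iff_smul_mem]; simp) (singleton_nonempty _)
    (x := x) (by simpa using hx0)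
  have hmem : x ∈ ⋃ f : X →L[𝕜] 𝕜, {x | f x ≠ 0} :=
    mem_iUnion.2 ⟨f, norm_pos_iff.1 (one_pos.trans hfx)⟩
  rw [← hTu] at hmem
  obtain ⟨f', hf', hx'⟩ := mem_iUnion₂.1 hmem
  obtain ⟨k, rfl⟩ : f' ∈ range g := hg ▸ mem_insert_of_mem _ hf'
  exact hx' (hx k)

end Total

section Blocks

variable {𝕜 X : Type*} [RCLike 𝕜] [AddCommGroup X] [Module 𝕜 X] [TopologicalSpace X]
  [IsTopologicalAddGroup X] [ContinuousSMul 𝕜 X]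

theorem apply_eq_zero_of_mem_closure_span {s : Set X} {ℓ : X →L[𝕜] 𝕜} (h : ∀ y ∈ s, ℓ y = 0) {x : X}
    (hx : x ∈ (Submodule.span 𝕜 s).topologicalClosure) : ℓ x = 0 :=
  Submodule.topologicalClosure_minimal (t := (ℓ : X →ₗ[𝕜] 𝕜).ker) _ (Submodule.span_le.2 h)
    ℓ.isClosed_ker hx

/-- From a biorthogonal sequence, the sums over infinitely many blocks of indices span a closed
infinite-dimensional subspace on which the coordinate functionals are proportional within
each block and jointly separate points. -/
theorem exists_closed_submodule_of_biorthogonal {u : ℕ → X} {f g : ℕ → X →L[𝕜] 𝕜} {m : ℕ → ℕ}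
    (hm : Function.Surjective m) (hsum : ∀ k, Summable fun j => if m j = k then u j else 0)
    (hfu : ∀ i j, i ≠ j → f i (u j) = 0) (hf : ∀ i, f i (u i) ≠ 0)
    (hg : ∀ x, (∀ k, g k x = 0) → x = 0) (hgu : ∀ i j, i < j → g i (u j) = 0) :
    ∃ F : Submodule 𝕜 X, IsClosed (F : Set X) ∧ ¬ FiniteDimensional 𝕜 F ∧
      (∀ x ∈ F, ∀ i j, m i = m j → f i x * f j (u j) = f j x * f i (u i)) ∧
      ∀ x ∈ F, (∀ i, f i x = 0) → x = 0 := by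
  let x : ℕ → X := fun k => ∑' j, if m j = k then u j else 0
  have hfx : ∀ i k, f i (x k) = if m i = k then f i (u i) else 0 := by
    intro i k
    simp only [x]
    rw [(f i).map_tsum (hsum k), tsum_eq_single i]
    · split_ifs <;> simp
    · intro j hj
      split_ifs
      · exact hfu i j hj.symm
      · exact map_zero _
  have hgx : ∀ l k, g l (x k) = ∑ i ∈ Finset.range (l + 1),
      g l (u i) * ((f i (u i))⁻¹ * f i (x k)) := by
    intro l k
    have : ∀ i, g l (u i) * ((f i (u i))⁻¹ * f i (x k)) = g l (if m i = k then u i else 0) := by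
      intro i
      rw [hfx]
      split_ifs
      · rw [inv_mul_cancel₀ (hf i), mul_one]
      · simp
    simp only [this]
    simp only [x]
    rw [(g l).map_tsum (hsum k), tsum_eq_sum]
    intro j hj
    split_ifs
    · exact hgu l j (by rw [Finset.mem_range] at hj; lia)
    · exact map_zero _
  refine ⟨(Submodule.span 𝕜 (range x)).topologicalClosure, Submodule.isClosed_topologicalClosure _,
    ?_, ?_, ?_⟩
  · intro hfin
    choose i hi using hm
    have hli : LinearIndependent 𝕜 x := by
      refine LinearIndependent.of_pairwise_dual_eq_zero_one x
        (fun k => (f (i k) (u (i k)))⁻¹ • (f (i k) : X →ₗ[𝕜] 𝕜)) ?_ ?_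
      · intro k l hkl
        simp [hfx, hi, hkl]
      · intro k
        simp [hfx, hi, hf]
    have hxF : ∀ k, x k ∈ (Submodule.span 𝕜 (range x)).topologicalClosure := fun k =>
      Submodule.le_topologicalClosure (Submodule.span 𝕜 (range x))
        (Submodule.subset_span (mem_range_self k))
    let x' : ℕ → (Submodule.span 𝕜 (range x)).topologicalClosure := fun k => ⟨x k, hxF k⟩
    have hli' : LinearIndependent 𝕜 x' :=
      LinearIndependent.of_comp (Submodule.span 𝕜 (range x)).topologicalClosure.subtype hli
    have := hli'.finite
    exact not_finite ℕ
  · intro y hy i j hij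
    have := apply_eq_zero_of_mem_closure_span (ℓ := f j (u j) • f i - f i (u i) • f j) ?_ hy
    · simp only [sub_apply, smul_apply, smul_eq_mul] at this
      linear_combination this
    · rintro _ ⟨k, rfl⟩
      simp only [sub_apply, smul_apply, smul_eq_mul, hfx, hij]
      split_ifs <;> ring
  · intro y hy hy0
    refine hg y fun l => ?_
    have := apply_eq_zero_of_mem_closure_span (ℓ := g l - ∑ i ∈ Finset.range (l + 1),
      (g l (u i) * (f i (u i))⁻¹) • f i) ?_ hy
    · simpa [hy0] using this
    · rintro _ ⟨k, rfl⟩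
      simp [hgx l k, mul_assoc]

end Blocks

section Separable

variable {𝕜 X : Type*} [RCLike 𝕜] [AddCommGroup X] [Module 𝕜 X] [UniformSpace X]
  [IsUniformAddGroup X] [ContinuousSMul 𝕜 X] [CompleteSpace X] [T2Space X]
  [SecondCountableTopology X] [Module ℝ X] [IsScalarTower ℝ 𝕜 X] [LocallyConvexSpace ℝ X]
  {W : ℕ → Type*} [∀ n, AddCommGroup (W n)] [∀ n, Module 𝕜 (W n)] [∀ n, UniformSpace (W n)]
  [∀ n, IsUniformAddGroup (W n)] [∀ n, ContinuousSMul 𝕜 (W n)] [∀ n, CompleteSpace (W n)]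
  [∀ n, FirstCountableTopology (W n)] [∀ n, Module ℝ (W n)] [∀ n, IsScalarTower ℝ 𝕜 (W n)]
  [∀ n, LocallyConvexSpace ℝ (W n)]

/-- A proper dense subspace of a separable Fréchet space which is a countable union of Fréchet
operator ranges has spaceable complement. -/
theorem exists_closed_submodule_inf_eq_bot_of_dense (S : ∀ n, W n →L[𝕜] X) {Y : Submodule 𝕜 X}
    (hSY : ∀ n, (S n).range ≤ Y) (hYS : ∀ y ∈ Y, ∃ n, y ∈ (S n).range)
    (hd : Dense (Y : Set X)) (hY : Y ≠ ⊤) :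
    ∃ F : Submodule 𝕜 X, IsClosed (F : Set X) ∧ ¬ FiniteDimensional 𝕜 F ∧ F ⊓ Y = ⊥ := by
  classical
  choose U hU hbad using fun n => exists_nhds_not_unifBddNearZero (S n) (hSY n) hY
  obtain ⟨g, hg⟩ := exists_seq_apply_eq_zero_imp_eq_zero 𝕜 X
  obtain ⟨V, hV, hVadd⟩ := IsTopologicalAddGroup.exists_antitone_basis_nhds_zero X
  let a : ℕ → ℕ := fun j => (Nat.unpair (Nat.unpair j).1).1
  let m : ℕ → ℕ := fun j => (Nat.unpair (Nat.unpair j).1).2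
  obtain ⟨p, hp, hpr⟩ := exists_seq_of_forall_nat_finset_exists
    (α := X × (X →L[𝕜] 𝕜))
    (fun j p => p.1 ∈ Y ∧ p.1 ∈ V j ∧ (∀ i < j, g i p.1 = 0) ∧
      (∀ b ∈ U (a j), ‖p.2 (S (a j) b)‖ ≤ 1) ∧ (j : ℝ) < ‖p.2 p.1‖)
    (fun q p => q.2 p.1 = 0 ∧ p.2 q.1 = 0) (by
      intro j s hs
      obtain ⟨u, huY, huV, huΦ, f, hf, hfu⟩ := exists_small_mem_large_apply hd (hbad (a j))
        (s.image Prod.snd ∪ (Finset.range j).image g) (s := s.image Prod.fst) (by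
          intro x hx
          obtain ⟨q, hq, rfl⟩ := Finset.mem_image.1 hx
          obtain ⟨_, h⟩ := hs q hq
          exact h.1) (hV.mem j) j
      refine ⟨(u, f), ⟨huY, huV, fun i hi => huΦ _ ?_, fun b hb => hf.1 _ ⟨b, hb, rfl⟩, hfu⟩,
        fun q hq => ⟨huΦ _ ?_, hf.2 _ ?_⟩⟩
      · exact Finset.mem_union_right _ (Finset.mem_image_of_mem g (Finset.mem_range.2 hi))
      · exact Finset.mem_union_left _ (Finset.mem_image_of_mem _ hq)
      · exact Finset.mem_image_of_mem _ hq)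
  have hlarge : ∀ j : ℕ, (j : ℝ) < ‖(p j).2 (p j).1‖ := fun j => (hp j).2.2.2.2
  have hne : ∀ j, (p j).2 (p j).1 ≠ 0 := fun j =>
    norm_pos_iff.1 ((Nat.cast_nonneg j).trans_lt (hlarge j))
  obtain ⟨F, hFc, hFd, hFm, hF0⟩ := exists_closed_submodule_of_biorthogonal
    (u := fun j => (p j).1) (f := fun j => (p j).2) (g := g) (m := m)
    (fun k => ⟨Nat.pair (Nat.pair 0 k) 0, by simp [m]⟩)
    (fun k => summable_of_add_subset hV hVadd fun j => by
      split_ifs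
      · exact (hp j).2.1
      · exact mem_of_mem_nhds (hV.mem j))
    (fun i j hij => by
      rcases hij.lt_or_gt with h | h
      · exact (hpr i j h).1
      · exact (hpr j i h).2)
    hne hg (fun i j hij => (hp j).2.2.1 i hij)
  refine ⟨F, hFc, hFd, (Submodule.eq_bot_iff _).2 ?_⟩
  rintro x ⟨hxF, hxY⟩
  refine hF0 x hxF fun i => ?_
  by_contra hi
  obtain ⟨n, w, rfl⟩ := hYS x hxY
  obtain ⟨c, hc, hcw⟩ : ∃ c : 𝕜, c ≠ 0 ∧ c • w ∈ U n := by
    have h := (absorbent_nhds_zero (hU n) : Absorbent 𝕜 (U n)).eventually_nhdsNE_zero w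
    obtain ⟨c, hc, hc0⟩ := (h.and self_mem_nhdsWithin).exists
    exact ⟨c, hc0, hc⟩
  have hbound : ∀ j, a j = n → ‖c‖ * ‖(p j).2 (S n w)‖ ≤ 1 := by
    rintro j rfl
    have := (hp j).2.2.2.1 _ hcw
    rwa [map_smul, map_smul, norm_smul] at this
  have hpos : 0 < ‖c‖ * ‖(p i).2 (S n w)‖ := mul_pos (norm_pos_iff.2 hc) (norm_pos_iff.2 hi)
  obtain ⟨N, hN⟩ := exists_nat_gt (‖(p i).2 (p i).1‖ / (‖c‖ * ‖(p i).2 (S n w)‖))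
  let j := Nat.pair (Nat.pair n (m i)) N
  have haj : a j = n := by simp [a, j]
  have hmj : m j = m i := by simp [m, j]
  have hNj : (N : ℝ) ≤ j := Nat.cast_le.2 (Nat.right_le_pair _ _)
  have h1 := congrArg norm (hFm _ hxF i j hmj.symm)
  rw [norm_mul, norm_mul] at h1
  rw [div_lt_iff₀ hpos] at hN
  have h2 := hbound j haj
  have h3 := hlarge j
  have h4 : ‖c‖ * ‖(p j).2 (S n w)‖ * ‖(p i).2 (p i).1‖ ≤ ‖(p i).2 (p i).1‖ :=
    mul_le_of_le_one_left (norm_nonneg _) h2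
  have h5 : (N : ℝ) * (‖c‖ * ‖(p i).2 (S n w)‖) ≤
      ‖(p j).2 (p j).1‖ * (‖c‖ * ‖(p i).2 (S n w)‖) :=
    mul_le_mul_of_nonneg_right (hNj.trans h3.le) hpos.le
  have h6 : ‖(p j).2 (p j).1‖ * (‖c‖ * ‖(p i).2 (S n w)‖) =
      ‖c‖ * ‖(p j).2 (S n w)‖ * ‖(p i).2 (p i).1‖ := by
    linear_combination ‖c‖ * h1
  linarith

end Separable

section Reduction

theorem mem_span_iUnion_range_iff {𝕜 : Type*} [Semiring 𝕜] {Z : ℕ → Type*}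
    [∀ n, AddCommMonoid (Z n)] [∀ n, Module 𝕜 (Z n)] {X : Type*} [AddCommMonoid X] [Module 𝕜 X]
    (T : ∀ n, Z n →ₗ[𝕜] X) {y : X} : y ∈ Submodule.span 𝕜 (⋃ n, range (T n)) ↔
      ∃ n, ∃ z : ∀ i : Fin n, Z i, ∑ i : Fin n, T i (z i) = y := by
  classical
  constructor
  · intro hy
    simp_rw [Submodule.span_iUnion, ← LinearMap.coe_range, Submodule.span_eq] at hy
    obtain ⟨f, rfl⟩ := (Submodule.mem_iSup_iff_exists_dfinsupp' _ _).1 hy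
    choose z hz using fun i => (f i).2
    refine ⟨f.support.sup id + 1, fun i => z i, ?_⟩
    rw [Fin.sum_univ_eq_sum_range (fun i => T i (z i)), DFinsupp.sum]
    simp_rw [hz]
    refine (Finset.sum_subset (fun i hi => ?_) fun i _ hi => ?_).symm
    · exact Finset.mem_range.2 (Nat.lt_succ_of_le (Finset.le_sup (f := id) hi))
    · simpa using hi
  · rintro ⟨n, z, rfl⟩
    exact Submodule.sum_mem _ fun i _ =>
      Submodule.subset_span (mem_iUnion.2 ⟨i, mem_range_self _⟩)

variable {𝕜 X : Type*} [RCLike 𝕜] [AddCommGroup X] [Module 𝕜 X] [UniformSpace X]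
  [IsUniformAddGroup X] [ContinuousSMul 𝕜 X] [CompleteSpace X]
  [TopologicalSpace.MetrizableSpace X] [Module ℝ X] [IsScalarTower ℝ 𝕜 X] [LocallyConvexSpace ℝ X]
  {W : ℕ → Type*} [∀ n, AddCommGroup (W n)] [∀ n, Module 𝕜 (W n)] [∀ n, UniformSpace (W n)]
  [∀ n, IsUniformAddGroup (W n)] [∀ n, ContinuousSMul 𝕜 (W n)] [∀ n, CompleteSpace (W n)]
  [∀ n, FirstCountableTopology (W n)] [∀ n, Module ℝ (W n)] [∀ n, IsScalarTower ℝ 𝕜 (W n)]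
  [∀ n, LocallyConvexSpace ℝ (W n)]

/-- A non-closed subspace of a Fréchet space which is a countable union of Fréchet operator ranges
has spaceable complement. -/
theorem exists_closed_submodule_inf_eq_bot_of_not_isClosed (S : ∀ n, W n →L[𝕜] X)
    {Y : Submodule 𝕜 X} (hYS : ∀ y, y ∈ Y ↔ ∃ n, y ∈ (S n).range)
    (hY : ¬ IsClosed (Y : Set X)) :
    ∃ F : Submodule 𝕜 X, IsClosed (F : Set X) ∧ ¬ FiniteDimensional 𝕜 F ∧ F ⊓ Y = ⊥ := by
  obtain ⟨y, hyc, hyY⟩ : ∃ y ∈ closure (Y : Set X), y ∉ Y := by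
    by_contra! h
    exact hY (closure_subset_iff_isClosed.1 h)
  obtain ⟨v, hvY, hv⟩ := mem_closure_iff_seq_limit.1 hyc
  let X' : Submodule 𝕜 X := (Submodule.span 𝕜 (range v)).topologicalClosure
  have hX' : IsClosed (X' : Set X) := Submodule.isClosed_topologicalClosure _
  have hvX' : range v ⊆ X' := fun x hx =>
    (Submodule.span 𝕜 (range v)).le_topologicalClosure (Submodule.subset_span hx)
  have hspan : Submodule.span 𝕜 (range v) ≤ Y := Submodule.span_le.2 (range_subset_iff.2 hvY)
  have hyX' : y ∈ X' := hX'.mem_of_tendsto hv (Eventually.of_forall fun n => hvX' (mem_range_self n))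
  have : IsUniformAddGroup X' := X'.toAddSubgroup.isUniformAddGroup
  have : CompleteSpace X' := hX'.completeSpace_coe
  have : LocallyConvexSpace ℝ X' := X'.locallyConvexSpace_real
  have : SecondCountableTopology X' := by
    have hsep : TopologicalSpace.IsSeparable (X' : Set X) :=
      ((countable_range v).isSeparable.span (R := 𝕜)).closure
    have := hsep.separableSpace
    have : FirstCountableTopology X' := Topology.IsInducing.subtypeVal.firstCountableTopology
    have : (uniformity X').IsCountablyGenerated :=
      IsUniformAddGroup.uniformity_countably_generated
    exact UniformSpace.secondCountable_of_separable X'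
  let W' : ∀ n, Submodule 𝕜 (W n) := fun n => X'.comap (S n : W n →ₗ[𝕜] X)
  have hW' : ∀ n, IsClosed (W' n : Set (W n)) := fun n => hX'.preimage (S n).continuous
  have : ∀ n, IsUniformAddGroup (W' n) := fun n => (W' n).toAddSubgroup.isUniformAddGroup
  have : ∀ n, CompleteSpace (W' n) := fun n => (hW' n).completeSpace_coe
  have : ∀ n, LocallyConvexSpace ℝ (W' n) := fun n => (W' n).locallyConvexSpace_real
  have : ∀ n, FirstCountableTopology (W' n) := fun n =>
    Topology.IsInducing.subtypeVal.firstCountableTopology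
  let S' : ∀ n, W' n →L[𝕜] X' := fun n =>
    ((S n).comp (W' n).subtypeL).codRestrict X' fun w => w.2
  have h₁ : ∀ n, (S' n).range ≤ Y.comap X'.subtype := by
    rintro n _ ⟨w, rfl⟩
    exact (hYS _).2 ⟨n, w, rfl⟩
  have h₂ : ∀ x ∈ Y.comap X'.subtype, ∃ n, x ∈ (S' n).range := by
    intro x hx
    obtain ⟨n, w, hw⟩ := (hYS _).1 hx
    have hw' : S n w = x := hw
    exact ⟨n, ⟨w, by simp [W', hw']⟩, Subtype.ext hw⟩
  have h₃ : Dense (Y.comap X'.subtype : Set X') := by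
    intro x
    rw [closure_subtype]
    refine closure_mono ?_ x.2
    intro z hz
    exact ⟨⟨z, (Submodule.span 𝕜 (range v)).le_topologicalClosure hz⟩, hspan hz, rfl⟩
  have h₄ : Y.comap X'.subtype ≠ ⊤ := by
    intro htop
    have : (⟨y, hyX'⟩ : X') ∈ Y.comap X'.subtype := htop ▸ Submodule.mem_top
    exact hyY this
  obtain ⟨F, hFc, hFd, hFY⟩ := exists_closed_submodule_inf_eq_bot_of_dense S' h₁ h₂ h₃ h₄
  refine ⟨F.map X'.subtype, ?_, ?_, ?_⟩
  · exact hX'.isClosedEmbedding_subtypeVal.isClosedMap _ hFc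
  · intro hfin
    exact hFd (FiniteDimensional.of_injective _
      (X'.subtype.submoduleMap_injective X'.injective_subtype F))
  · rw [Submodule.eq_bot_iff]
    rintro _ ⟨⟨x, hx, rfl⟩, hxY⟩
    have : x ∈ F ⊓ Y.comap X'.subtype := ⟨hx, hxY⟩
    rw [hFY, Submodule.mem_bot] at this
    rw [this, map_zero]

end Reduction

end FrechetRanges

/-- **Theorem 3.1 of the paper** (Fréchet version of Kitson–Timoney): if `X` is a Fréchet
space, `(Z n)` a countable family of Fréchet spaces and `T n : Z n → X` continuous linear
operators such that `Y = span (⋃ n, T n (Z n))` is not closed in `X`, then `X \ Y` is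
spaceable: there is a closed infinite-dimensional subspace `F₀` of `X` with `F₀ ∩ Y = {0}`. -/
theorem frechet_kitson_timoney (𝕜 : Type*) [RCLike 𝕜]
    (Z : ℕ → Type*) [∀ n, AddCommGroup (Z n)] [∀ n, Module 𝕜 (Z n)]
    [∀ n, UniformSpace (Z n)] [∀ n, IsUniformAddGroup (Z n)]
    [∀ n, ContinuousSMul 𝕜 (Z n)] [∀ n, CompleteSpace (Z n)]
    [∀ n, TopologicalSpace.MetrizableSpace (Z n)]
    [∀ n, Module ℝ (Z n)] [∀ n, IsScalarTower ℝ 𝕜 (Z n)] [∀ n, LocallyConvexSpace ℝ (Z n)]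
    (X : Type*) [AddCommGroup X] [Module 𝕜 X] [UniformSpace X] [IsUniformAddGroup X]
    [ContinuousSMul 𝕜 X] [CompleteSpace X] [TopologicalSpace.MetrizableSpace X]
    [Module ℝ X] [IsScalarTower ℝ 𝕜 X] [LocallyConvexSpace ℝ X]
    (T : ∀ n, Z n →L[𝕜] X)
    (hY : ¬ IsClosed ((Submodule.span 𝕜 (⋃ n, Set.range (T n)) : Submodule 𝕜 X) : Set X)) :
    ∃ F₀ : Submodule 𝕜 X, IsClosed (F₀ : Set X) ∧ ¬ FiniteDimensional 𝕜 F₀ ∧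
      F₀ ⊓ Submodule.span 𝕜 (⋃ n, Set.range (T n)) = ⊥ := by
  let S : ∀ n, (∀ i : Fin n, Z i) →L[𝕜] X := fun n =>
    ∑ i : Fin n, (T i).comp (ContinuousLinearMap.proj i)
  refine exists_closed_submodule_inf_eq_bot_of_not_isClosed S (fun y => ?_) hY
  have h := mem_span_iUnion_range_iff (fun n => (T n : Z n →ₗ[𝕜] X)) (y := y)
  simpa [S] using h
end

section
/- Let X be a Fréchet space and let Y be a linear subspace of X that is not closed in X. Then there exists a closed, separable linear subspace X̃ of X such that Y ∩ X̃ is not closed in X̃. Moreover, any linear subspace F of X̃ that is closed in X̃ and satisfies F ∩ (Y ∩ X̃) = {0} is closed in X and satisfies F ∩ Y = {0}. -/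
/-- Reduction to a separable closed subspace: if `Y` is a non-closed subspace of a Fréchet
space `X`, there is a closed separable subspace `X̃` of `X` in which `Y ∩ X̃` is not closed;
moreover any subspace `F` of `X̃` which is closed in `X̃` and meets `Y ∩ X̃` only at `0` is
closed in `X` and meets `Y` only at `0`. -/
theorem separable_reduction (𝕜 : Type*) [RCLike 𝕜] (X : Type*)
    [AddCommGroup X] [Module 𝕜 X] [UniformSpace X] [IsUniformAddGroup X]
    [ContinuousSMul 𝕜 X] [CompleteSpace X] [TopologicalSpace.MetrizableSpace X]
    [Module ℝ X] [IsScalarTower ℝ 𝕜 X] [LocallyConvexSpace ℝ X]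
    (Y : Submodule 𝕜 X) (hY : ¬ IsClosed (Y : Set X)) :
    ∃ Xt : Submodule 𝕜 X, IsClosed (Xt : Set X) ∧
      TopologicalSpace.SeparableSpace Xt ∧
      ¬ IsClosed {x : Xt | (x : X) ∈ Y} ∧
      ∀ F : Submodule 𝕜 X, F ≤ Xt → IsClosed {x : Xt | (x : X) ∈ F} →
        F ⊓ (Y ⊓ Xt) = ⊥ → IsClosed (F : Set X) ∧ F ⊓ Y = ⊥ := by
  obtain ⟨x, hxcl, hxY⟩ : ∃ x ∈ closure (Y : Set X), x ∉ Y := by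
    by_contra! h
    exact hY (isClosed_of_closure_subset h)
  obtain ⟨u, huY, hux⟩ := mem_closure_iff_seq_limit.1 hxcl
  set Xt := (Submodule.span 𝕜 (Set.range u)).topologicalClosure
  have hXt : IsClosed (Xt : Set X) := Submodule.isClosed_topologicalClosure _
  have huXt (n : ℕ) : u n ∈ Xt :=
    Submodule.le_topologicalClosure _ (Submodule.subset_span (Set.mem_range_self n))
  have hxXt : x ∈ Xt := hXt.mem_of_tendsto hux (.of_forall huXt)
  refine ⟨Xt, hXt, ?_, fun hcl => hxY ?_, fun F hF hFcl hFY => ⟨?_, ?_⟩⟩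
  · have hsep : TopologicalSpace.IsSeparable (Submodule.span 𝕜 (Set.range u) : Set X) :=
      (Set.countable_range u).isSeparable.span
    exact hsep.closure.separableSpace
  · have hlim : Filter.Tendsto (fun n => (⟨u n, huXt n⟩ : Xt)) Filter.atTop (nhds ⟨x, hxXt⟩) :=
      tendsto_subtype_rng.2 hux
    exact hcl.mem_of_tendsto hlim (.of_forall huY)
  · have himage : ((↑) : Xt → X) '' {x : Xt | (x : X) ∈ F} = F := by
      ext y
      exact ⟨fun ⟨z, hz, hzy⟩ => hzy ▸ hz, fun hy => ⟨⟨y, hF hy⟩, hy, rfl⟩⟩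
    exact himage ▸ hXt.isClosedEmbedding_subtypeVal.isClosedMap _ hFcl
  · rwa [inf_comm Y, ← inf_assoc, inf_eq_left.2 hF] at hFY
end

section
/- Let X̃ be a separable, metrizable, Hausdorff locally convex topological vector space over 𝕂 ∈ {ℝ, ℂ}, and let A ⊆ X̃ be any subset. Then there exists a countable family (C_j)_{j ∈ ℕ} of closed convex subsets of X̃ with 0 ∉ C_j for every j, such that A \ {0} = ⋃_{j ∈ ℕ} (C_j ∩ A). -/
open Topology in
theorem LocallyConvexSpace.exists_isClosed_convex_mem_nhds {X : Type*} [AddCommGroup X]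
    [Module ℝ X] [TopologicalSpace X] [IsTopologicalAddGroup X] [ContinuousConstSMul ℝ X]
    [LocallyConvexSpace ℝ X] {a : X} {U : Set X} (hU : U ∈ 𝓝 a) :
    ∃ K ∈ 𝓝 a, IsClosed K ∧ Convex ℝ K ∧ K ⊆ U := by
  obtain ⟨F, ⟨hFa, hF⟩, hFU⟩ := (closed_nhds_basis a).mem_iff.1 hU
  obtain ⟨W, ⟨hWa, hW⟩, hWF⟩ :=
    (LocallyConvexSpace.convex_basis (𝕜 := ℝ) a).mem_iff.1 hFa
  exact ⟨closure W, Filter.mem_of_superset hWa subset_closure, isClosed_closure, hW.closure,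
    (closure_minimal hWF hF).trans hFU⟩

open Topology in
theorem exists_seq_isClosed_convex_iUnion_eq {X : Type*} [AddCommGroup X]
    [Module ℝ X] [TopologicalSpace X] [IsTopologicalAddGroup X] [ContinuousConstSMul ℝ X]
    [LocallyConvexSpace ℝ X] [SecondCountableTopology X] {U : Set X} (hU : IsOpen U) :
    ∃ C : ℕ → Set X, (∀ j, IsClosed (C j) ∧ Convex ℝ (C j) ∧ C j ⊆ U) ∧ ⋃ j, C j = U := by
  have hloc : ∀ a ∈ U, ∃ K ∈ 𝓝 a, IsClosed K ∧ Convex ℝ K ∧ K ⊆ U := fun a ha ↦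
    LocallyConvexSpace.exists_isClosed_convex_mem_nhds (hU.mem_nhds ha)
  choose! K hKnhds hK using hloc
  obtain ⟨t, htU, htc, hcover⟩ := TopologicalSpace.countable_cover_nhdsWithin
    fun a ha ↦ mem_nhdsWithin_of_mem_nhds (hKnhds a ha)
  obtain ⟨C, hC⟩ := ((htc.image K).insert ∅).exists_eq_range (Set.insert_nonempty _ _)
  have hCprop (j : ℕ) : IsClosed (C j) ∧ Convex ℝ (C j) ∧ C j ⊆ U := by
    have hj : C j ∈ insert ∅ (K '' t) := hC ▸ Set.mem_range_self j
    rcases hj with hj | ⟨a, hat, hj⟩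
    · rw [hj]
      exact ⟨isClosed_empty, convex_empty, Set.empty_subset U⟩
    · exact hj ▸ hK a (htU hat)
  refine ⟨C, hCprop, (Set.iUnion_subset fun j ↦ (hCprop j).2.2).antisymm fun x hx ↦ ?_⟩
  obtain ⟨a, hat, hxa⟩ := Set.mem_iUnion₂.1 (hcover hx)
  obtain ⟨j, hj⟩ : K a ∈ Set.range C := hC ▸ Or.inr (Set.mem_image_of_mem K hat)
  exact Set.mem_iUnion.2 ⟨j, hj ▸ hxa⟩

/-- In a separable metrizable Hausdorff locally convex space, for any subset `A`, the set
`A \ {0}` can be covered by countably many closed convex sets avoiding the origin, in the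
precise sense that `A \ {0} = ⋃ j, (C j ∩ A)`. -/
theorem countable_closed_convex_cover (𝕜 : Type*) [RCLike 𝕜] (X : Type*)
    [AddCommGroup X] [Module 𝕜 X] [TopologicalSpace X] [IsTopologicalAddGroup X]
    [ContinuousSMul 𝕜 X] [T2Space X] [TopologicalSpace.MetrizableSpace X]
    [TopologicalSpace.SeparableSpace X]
    [Module ℝ X] [IsScalarTower ℝ 𝕜 X] [LocallyConvexSpace ℝ X]
    (A : Set X) :
    ∃ C : ℕ → Set X,
      (∀ j, IsClosed (C j) ∧ Convex ℝ (C j) ∧ (0 : X) ∉ C j) ∧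
      A \ {0} = ⋃ j, C j ∩ A := by
  have : ContinuousSMul ℝ X := IsScalarTower.continuousSMul 𝕜
  let _ := TopologicalSpace.metrizableSpaceMetric X
  have : SecondCountableTopology X := UniformSpace.secondCountable_of_separable X
  obtain ⟨C, hC, hCU⟩ :=
    exists_seq_isClosed_convex_iUnion_eq (isOpen_compl_singleton (x := (0 : X)))
  refine ⟨C, fun j ↦ ⟨(hC j).1, (hC j).2.1, fun h ↦ (hC j).2.2 h rfl⟩, ?_⟩
  rw [← Set.iUnion_inter, hCU, Set.inter_comm, Set.sdiff_eq]
end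

section
/- Let X be a Fréchet space, let {Z_i}_{i ∈ I} be an arbitrary family of Fréchet spaces, and for each i ∈ I let T_i : Z_i → X be a continuous linear operator. If Y := span(⋃_{i ∈ I} T_i(Z_i)) is not closed in X, then there exists a countable subset I₀ ⊆ I such that Y₀ := span(⋃_{i ∈ I₀} T_i(Z_i)) is not closed in X. -/
/-- An element of the span of a union lies in the span of the union over a finite
set of indices. -/
theorem Submodule.exists_finite_mem_span_biUnion {R M I : Type*} [Semiring R] [AddCommMonoid M]
    [Module R M] {s : I → Set M} {x : M} (hx : x ∈ Submodule.span R (⋃ i, s i)) :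
    ∃ J : Set I, J.Finite ∧ x ∈ Submodule.span R (⋃ i ∈ J, s i) := by
  induction hx using Submodule.span_induction with
  | mem x h =>
    obtain ⟨i, hi⟩ := Set.mem_iUnion.1 h
    exact ⟨{i}, Set.finite_singleton i, Submodule.subset_span (by simpa using hi)⟩
  | zero => exact ⟨∅, Set.finite_empty, Submodule.zero_mem _⟩
  | add x y _ _ ihx ihy =>
    obtain ⟨J, hJ, hxJ⟩ := ihx
    obtain ⟨K, hK, hyK⟩ := ihy
    refine ⟨J ∪ K, hJ.union hK, Submodule.add_mem _ ?_ ?_⟩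
    · exact Submodule.span_mono (Set.biUnion_subset_biUnion_left Set.subset_union_left) hxJ
    · exact Submodule.span_mono (Set.biUnion_subset_biUnion_left Set.subset_union_right) hyK
  | smul a x _ ih =>
    obtain ⟨J, hJ, hxJ⟩ := ih
    exact ⟨J, hJ, Submodule.smul_mem _ a hxJ⟩

/-- In a module with a Fréchet–Urysohn topology, if the span of a union is not closed,
then neither is the span of some countable subunion. -/
theorem Submodule.exists_countable_not_isClosed_span_biUnion {R M I : Type*} [Semiring R]
    [AddCommMonoid M] [Module R M] [TopologicalSpace M] [FrechetUrysohnSpace M] {s : I → Set M}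
    (hY : ¬ IsClosed (Submodule.span R (⋃ i, s i) : Set M)) :
    ∃ J : Set I, J.Countable ∧ ¬ IsClosed (Submodule.span R (⋃ i ∈ J, s i) : Set M) := by
  obtain ⟨y, hy, hyY⟩ := Set.not_subset.1 fun h => hY (isClosed_of_closure_subset h)
  obtain ⟨u, hu, hlim⟩ := mem_closure_iff_seq_limit.1 hy
  have hfin (n : ℕ) := Submodule.exists_finite_mem_span_biUnion (hu n)
  choose J hJ huJ using hfin
  refine ⟨⋃ n, J n, Set.countable_iUnion fun n => (hJ n).countable, fun hclosed => hyY ?_⟩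
  have hu' (n : ℕ) : u n ∈ Submodule.span R (⋃ i ∈ ⋃ n, J n, s i) :=
    Submodule.span_mono (Set.biUnion_subset_biUnion_left (Set.subset_iUnion J n)) (huJ n)
  have hmem : y ∈ Submodule.span R (⋃ i ∈ ⋃ n, J n, s i) :=
    hclosed.mem_of_tendsto hlim (Filter.Eventually.of_forall hu')
  have hsub : (⋃ i ∈ ⋃ n, J n, s i) ⊆ ⋃ i, s i :=
    Set.iUnion_mono fun i => Set.iUnion_subset fun _ => subset_rfl
  exact Submodule.span_mono hsub hmem

/-- Countable reduction (from the proof of the general form): if the span of the ranges of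
an arbitrary family of continuous linear operators into a Fréchet space `X` is not closed,
then already the span of the ranges over some countable subfamily is not closed. -/
theorem countable_subfamily_not_closed (𝕜 : Type*) [RCLike 𝕜] (I : Type*)
    (Z : I → Type*) [∀ i, AddCommGroup (Z i)] [∀ i, Module 𝕜 (Z i)]
    [∀ i, UniformSpace (Z i)] [∀ i, IsUniformAddGroup (Z i)]
    [∀ i, ContinuousSMul 𝕜 (Z i)] [∀ i, CompleteSpace (Z i)]
    [∀ i, TopologicalSpace.MetrizableSpace (Z i)]
    [∀ i, Module ℝ (Z i)] [∀ i, IsScalarTower ℝ 𝕜 (Z i)] [∀ i, LocallyConvexSpace ℝ (Z i)]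
    (X : Type*) [AddCommGroup X] [Module 𝕜 X] [UniformSpace X] [IsUniformAddGroup X]
    [ContinuousSMul 𝕜 X] [CompleteSpace X] [TopologicalSpace.MetrizableSpace X]
    [Module ℝ X] [IsScalarTower ℝ 𝕜 X] [LocallyConvexSpace ℝ X]
    (T : ∀ i, Z i →L[𝕜] X)
    (hY : ¬ IsClosed ((Submodule.span 𝕜 (⋃ i, Set.range (T i)) : Submodule 𝕜 X) : Set X)) :
    ∃ I₀ : Set I, I₀.Countable ∧
      ¬ IsClosed ((Submodule.span 𝕜 (⋃ i ∈ I₀, Set.range (T i)) : Submodule 𝕜 X) : Set X) := by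
  exact Submodule.exists_countable_not_isClosed_span_biUnion hY
end

section
/- Let X be a Fréchet space and let Y be a linear subspace of X that is not closed in X and can be written as Y = ⋃_{N ∈ ℕ} S_N(E_N), where each E_N is a Fréchet space and each S_N : E_N → X is a continuous linear operator. Then Y has infinite codimension in X; in particular, there exists an infinite-dimensional linear subspace W of X with W ∩ Y = {0}. -/
open Filter Topology Set Pointwise

/-- A continuous additive homomorphism from a complete group with countably generated uniformity
which is almost open at `0` is open. -/
theorem AddMonoidHom.isOpenMap_of_closure_image_mem_nhds {E X : Type*}
    [AddCommGroup E] [UniformSpace E] [IsUniformAddGroup E] [CompleteSpace E]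
    [FirstCountableTopology E]
    [AddCommGroup X] [TopologicalSpace X] [IsTopologicalAddGroup X] [T2Space X]
    (f : E →+ X) (hf : Continuous f)
    (h : ∀ U ∈ 𝓝 (0 : E), closure (f '' U) ∈ 𝓝 (0 : X)) : IsOpenMap f := by
  rw [IsTopologicalAddGroup.isOpenMap_iff_nhds_zero]
  intro A hA
  rw [mem_map] at hA
  obtain ⟨C, hC, hCc, hCA⟩ := exists_mem_nhds_isClosed_subset hA
  obtain ⟨u, hu, hadd⟩ := IsTopologicalAddGroup.exists_antitone_basis_nhds_zero E
  have hum : ∀ n, u n ∈ 𝓝 (0 : E) := fun n ↦ hu.1.mem_of_mem trivial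
  obtain ⟨k, hk⟩ := hu.mem_iff.1 hC
  have hsmall : ∀ n (a b : E), a ∈ u (n + 1) → b ∈ u (n + 1) → a + b ∈ u n :=
    fun n a b ha hb ↦ hadd n (add_mem_add ha hb)
  refine mem_of_superset (h _ (hum (k + 1))) fun y hy ↦ ?_
  have step : ∀ n, ∀ z ∈ closure (f '' u n), ∃ x ∈ u n, z - f x ∈ closure (f '' u (n + 1)) := by
    intro n z hz
    have hnhds : {w | z - w ∈ closure (f '' u (n + 1))} ∈ 𝓝 z := by
      have : Tendsto (fun w ↦ z - w) (𝓝 z) (𝓝 0) := by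
        simpa using (continuous_const.sub continuous_id).tendsto (x := z) (f := fun w ↦ z - w)
      exact this (h _ (hum (n + 1)))
    obtain ⟨_, hw, x, hx, rfl⟩ := mem_closure_iff_nhds.1 hz _ hnhds
    exact ⟨x, hx, hw⟩
  choose! g hgu hgc using step
  let z : ℕ → X := fun n ↦ Nat.rec y (fun i w ↦ w - f (g (k + 1 + i) w)) n
  have hz0 : z 0 = y := rfl
  have hzs : ∀ n, z (n + 1) = z n - f (g (k + 1 + n) (z n)) := fun n ↦ rfl
  have hz : ∀ n, z n ∈ closure (f '' u (k + 1 + n)) := by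
    intro n
    induction n with
    | zero => exact hy
    | succ n ih => rw [hzs]; exact hgc _ _ ih
  let x : ℕ → E := fun n ↦ g (k + 1 + n) (z n)
  have hx : ∀ n, x n ∈ u (k + 1 + n) := fun n ↦ hgu _ _ (hz n)
  let s : ℕ → E := fun n ↦ ∑ i ∈ Finset.range n, x i
  have hzs' : ∀ n, z n = y - f (s n) := by
    intro n
    induction n with
    | zero => simp [s, hz0]
    | succ n ih =>
      rw [hzs, ih, show s (n + 1) = s n + x n from Finset.sum_range_succ _ _, map_add]
      simp only [x, ih]
      abel
  have htail : ∀ m n, ∑ i ∈ Finset.range m, x (n + i) ∈ u (k + n) := by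
    intro m
    induction m with
    | zero => intro n; simpa using mem_of_mem_nhds (hum (k + n))
    | succ m ih =>
      intro n
      rw [Finset.sum_range_succ']
      refine hsmall _ _ _ ?_ ?_
      · have := ih (n + 1)
        rw [show k + (n + 1) = k + n + 1 by ring] at this
        refine (congrArg (· ∈ u (k + n + 1)) (Finset.sum_congr rfl fun i _ ↦ ?_)).mp this
        congr 1; ring
      · have := hx n
        rwa [show k + 1 + n = k + n + 1 by ring] at this
  have hcauchy : CauchySeq s := by
    rw [cauchySeq_iff]
    intro V hV
    rw [uniformity_eq_comap_nhds_zero, mem_comap] at hV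
    obtain ⟨W, hW, hWV⟩ := hV
    obtain ⟨W', hW', hsub⟩ : ∃ W' ∈ 𝓝 (0 : E), ∀ a ∈ W', ∀ b ∈ W', a - b ∈ W :=
      exists_nhds_half_neg hW
    obtain ⟨n, hn⟩ := hu.mem_iff.1 hW'
    have key : ∀ p ≥ n, s p - s n ∈ W' := by
      intro p hp
      obtain ⟨m, rfl⟩ := Nat.exists_eq_add_of_le hp
      have : s (n + m) - s n = ∑ i ∈ Finset.range m, x (n + i) := by
        simp [s, Finset.sum_range_add]
      rw [this]
      exact hn (hu.antitone (Nat.le_add_left n k) (htail m n))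
    refine ⟨n, fun p hp q hq ↦ hWV ?_⟩
    have := hsub _ (key q hq) _ (key p hp)
    simpa using this
  obtain ⟨l, hl⟩ := cauchySeq_tendsto_of_complete hcauchy
  have hlC : l ∈ C := hCc.mem_of_tendsto hl
    (Eventually.of_forall fun n ↦ hk (by simpa using htail n 0))
  have hzlim : Tendsto z atTop (𝓝 0) := by
    rw [(closed_nhds_basis (0 : X)).tendsto_right_iff]
    rintro W ⟨hW, hWc⟩
    have : f ⁻¹' W ∈ 𝓝 (0 : E) := hf.continuousAt (by simpa using hW)
    obtain ⟨n, hn⟩ := hu.mem_iff.1 this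
    filter_upwards [eventually_ge_atTop n] with m hm
    refine closure_minimal ?_ hWc (hz m)
    rw [image_subset_iff]
    exact (hu.antitone (by omega)).trans hn
  have hlim : Tendsto z atTop (𝓝 (y - f l)) := by
    simp_rw [funext hzs']
    exact tendsto_const_nhds.sub ((hf.tendsto l).comp hl)
  have : y = f l := sub_eq_zero.1 (tendsto_nhds_unique hlim hzlim)
  exact this ▸ hCA hlC

/-- **Open mapping theorem** for complete metrizable topological vector spaces: a continuous linear
map with non-meagre range is open. -/
theorem ContinuousLinearMap.isOpenMap_of_not_isMeagre_range {𝕜 E X : Type*} [RCLike 𝕜]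
    [AddCommGroup E] [Module 𝕜 E] [UniformSpace E] [IsUniformAddGroup E] [ContinuousSMul 𝕜 E]
    [CompleteSpace E] [FirstCountableTopology E]
    [AddCommGroup X] [Module 𝕜 X] [TopologicalSpace X] [IsTopologicalAddGroup X]
    [ContinuousSMul 𝕜 X] [T2Space X]
    (f : E →L[𝕜] X) (h : ¬ IsMeagre (range f)) : IsOpenMap f := by
  refine AddMonoidHom.isOpenMap_of_closure_image_mem_nhds (f : E →+ X) f.continuous fun U hU ↦ ?_
  change closure (f '' U) ∈ 𝓝 0
  obtain ⟨V, hV, hVU⟩ : ∃ V ∈ 𝓝 (0 : E), ∀ a ∈ V, ∀ b ∈ V, a - b ∈ U :=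
    exists_nhds_half_neg hU
  have hc : ∀ n : ℕ, ((n : 𝕜) + 1) ≠ 0 := fun n ↦ Nat.cast_add_one_ne_zero n
  have hcover : range f ⊆ ⋃ n : ℕ, ((n : 𝕜) + 1) • (f '' V) := by
    rintro _ ⟨x, rfl⟩
    have hlim : Tendsto (fun n : ℕ ↦ (((n : 𝕜) + 1)⁻¹) • x) atTop (𝓝 0) := by
      have : Tendsto (fun n : ℕ ↦ ((n : 𝕜) + 1)⁻¹) atTop (𝓝 0) := by
        simpa using tendsto_one_div_add_atTop_nhds_zero_nat (𝕜 := 𝕜)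
      simpa using this.smul_const x
    obtain ⟨n, hn⟩ := (hlim.eventually hV).exists
    refine mem_iUnion.2 ⟨n, mem_smul_set.2 ⟨_, mem_image_of_mem f hn, ?_⟩⟩
    rw [map_smul, smul_inv_smul₀ (hc n)]
  obtain ⟨w, hw⟩ : (interior (closure (f '' V))).Nonempty := by
    by_contra hne
    rw [not_nonempty_iff_eq_empty] at hne
    refine h (IsMeagre.mono hcover (isMeagre_iUnion fun n : ℕ ↦ IsNowhereDense.isMeagre ?_))
    change interior (closure _) = ∅
    rw [closure_smul₀' (hc n), interior_smul₀ (hc n), hne, smul_set_empty]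
  have hnhds : {v | w + v ∈ closure (f '' V)} ∈ 𝓝 (0 : X) := by
    have : Tendsto (fun v ↦ w + v) (𝓝 0) (𝓝 w) := by
      simpa using (continuous_const.add continuous_id).tendsto (x := (0 : X)) (f := fun v ↦ w + v)
    exact this (mem_interior_iff_mem_nhds.1 hw)
  refine mem_of_superset hnhds fun v hv ↦ ?_
  have := map_mem_closure₂ (u := f '' U) continuous_sub hv (interior_subset hw) (by
    rintro _ ⟨a, ha, rfl⟩ _ ⟨b, hb, rfl⟩
    exact ⟨a - b, hVU a ha b hb, map_sub f a b⟩)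
  simpa using this

/-- A subspace of finite codimension which is a countable union of continuous linear images of
complete metrizable spaces is closed. -/
theorem Submodule.isClosed_of_finiteDimensional_quotient_of_eq_iUnion_range {𝕜 : Type*} [RCLike 𝕜]
    {E : ℕ → Type*} [∀ N, AddCommGroup (E N)] [∀ N, Module 𝕜 (E N)]
    [∀ N, UniformSpace (E N)] [∀ N, IsUniformAddGroup (E N)]
    [∀ N, ContinuousSMul 𝕜 (E N)] [∀ N, CompleteSpace (E N)]
    [∀ N, FirstCountableTopology (E N)]
    {X : Type*} [AddCommGroup X] [Module 𝕜 X] [TopologicalSpace X] [IsTopologicalAddGroup X]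
    [ContinuousSMul 𝕜 X] [T2Space X] [BaireSpace X]
    (S : ∀ N, E N →L[𝕜] X) (Y : Submodule 𝕜 X) (hYS : (Y : Set X) = ⋃ N, range (S N))
    [FiniteDimensional 𝕜 (X ⧸ Y)] : IsClosed (Y : Set X) := by
  obtain ⟨F, hF⟩ := Submodule.exists_isCompl Y
  have : FiniteDimensional 𝕜 F := (Y.quotientEquivOfIsCompl F hF).finiteDimensional
  let e := (Module.finBasis 𝕜 F).equivFun.symm
  let g₀ := F.subtype ∘ₗ e.toLinearMap
  let g : (Fin (Module.finrank 𝕜 F) → 𝕜) →L[𝕜] X := ⟨g₀, g₀.continuous_on_pi⟩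
  have hgF : ∀ v, g v ∈ F := fun v ↦ (e v).2
  have hgsurj : ∀ w ∈ F, ∃ v, g v = w := fun w hw ↦
    ⟨e.symm ⟨w, hw⟩, congrArg Subtype.val (e.apply_symm_apply ⟨w, hw⟩)⟩
  have hg0 : ∀ v, g v = 0 → v = 0 := fun v hv ↦
    e.map_eq_zero_iff.1 (Subtype.ext hv)
  have hSY : ∀ N x, S N x ∈ Y := fun N x ↦
    (Set.ext_iff.1 hYS _).2 (mem_iUnion.2 ⟨N, x, rfl⟩)
  obtain ⟨N, hN⟩ : ∃ N, ¬ IsMeagre (range ((S N).coprod g)) := by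
    by_contra! hall
    refine not_isMeagre_of_isOpen (X := X) isOpen_univ univ_nonempty
      (IsMeagre.mono (fun x _ ↦ ?_) (isMeagre_iUnion hall))
    obtain ⟨y, hy, w, hw, rfl⟩ :=
      Submodule.mem_sup.1 (hF.sup_eq_top ▸ Submodule.mem_top : x ∈ Y ⊔ F)
    obtain ⟨N, a, rfl⟩ := mem_iUnion.1 ((Set.ext_iff.1 hYS _).1 hy)
    obtain ⟨v, rfl⟩ := hgsurj w hw
    exact mem_iUnion.2 ⟨N, (a, v), by simp⟩
  have hopen := ((S N).coprod g).isOpenMap_of_not_isMeagre_range hN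
  have htop : ((S N).coprod g).range = ⊤ :=
    Submodule.eq_top_of_nonempty_interior' _ ⟨0, by
      have : IsOpen (((S N).coprod g).range : Set X) := by
        rw [LinearMap.coe_range]; exact hopen.isOpen_range
      rw [this.interior_eq]
      exact Submodule.zero_mem _⟩
  have hcompl : (Y : Set X)ᶜ = (S N).coprod g '' {p | p.2 ≠ 0} := by
    ext x
    obtain ⟨⟨a, v⟩, rfl⟩ := LinearMap.range_eq_top.1 htop x
    have hmem : ∀ a v, ((S N).coprod g (a, v)) ∈ Y ↔ v = 0 := by
      intro a v
      rw [ContinuousLinearMap.coprod_apply, Submodule.add_mem_iff_right _ (hSY N a)]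
      refine ⟨fun hv ↦ hg0 v (Submodule.disjoint_def.1 hF.disjoint _ hv (hgF v)), ?_⟩
      rintro rfl
      simp
    constructor
    · intro hx
      exact ⟨(a, v), fun hv ↦ hx ((hmem a v).2 hv), rfl⟩
    · rintro ⟨⟨b, v'⟩, hv', hb⟩ hx
      exact hv' ((hmem b v').1 (hb ▸ hx))
  rw [← isOpen_compl_iff, hcompl]
  exact hopen _ (isOpen_ne.preimage continuous_snd)


/-- A non-closed subspace `Y` of a Fréchet space `X` which is a countable union of
continuous linear images of Fréchet spaces has infinite codimension in `X`; in particular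
there is an infinite-dimensional subspace `W` of `X` with `W ∩ Y = {0}`. -/
theorem infinite_codimension_of_operator_range_union (𝕜 : Type*) [RCLike 𝕜]
    (E : ℕ → Type*) [∀ N, AddCommGroup (E N)] [∀ N, Module 𝕜 (E N)]
    [∀ N, UniformSpace (E N)] [∀ N, IsUniformAddGroup (E N)]
    [∀ N, ContinuousSMul 𝕜 (E N)] [∀ N, CompleteSpace (E N)]
    [∀ N, TopologicalSpace.MetrizableSpace (E N)]
    [∀ N, Module ℝ (E N)] [∀ N, IsScalarTower ℝ 𝕜 (E N)] [∀ N, LocallyConvexSpace ℝ (E N)]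
    (X : Type*) [AddCommGroup X] [Module 𝕜 X] [UniformSpace X] [IsUniformAddGroup X]
    [ContinuousSMul 𝕜 X] [CompleteSpace X] [TopologicalSpace.MetrizableSpace X]
    [Module ℝ X] [IsScalarTower ℝ 𝕜 X] [LocallyConvexSpace ℝ X]
    (S : ∀ N, E N →L[𝕜] X)
    (Y : Submodule 𝕜 X)
    (hYS : (Y : Set X) = ⋃ N, Set.range (S N))
    (hY : ¬ IsClosed (Y : Set X)) :
    ¬ FiniteDimensional 𝕜 (X ⧸ Y) ∧
      ∃ W : Submodule 𝕜 X, ¬ FiniteDimensional 𝕜 W ∧ W ⊓ Y = ⊥ := by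
  have hinf : ¬ FiniteDimensional 𝕜 (X ⧸ Y) := by
    intro hfin
    have := IsUniformAddGroup.uniformity_countably_generated (α := X)
    exact hY (Y.isClosed_of_finiteDimensional_quotient_of_eq_iUnion_range S hYS)
  obtain ⟨W, hW⟩ := Submodule.exists_isCompl Y
  exact ⟨hinf, W, fun hfin ↦ hinf (Y.quotientEquivOfIsCompl W hW).symm.finiteDimensional,
    hW.symm.inf_eq_bot⟩
end
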